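/- arXiv:2502.01363 — 8 statements merged into one kernel-verified Lean document; each statement's English description precedes it below -/
import Mathlib

section
/- Fix s > 0 and b ≥ 0, and define the Laplace transform of the drifted generalized counting process by p̃(s,t) = e^{-sbt} ∑_{n=0}^∞ e^{-sn} p(n,t) for t ≥ 0. Then p̃(s,t) = e^{-sbt} exp(-t ∑_{j=1}^k λ_j (1 - e^{-sj})); in particular p̃(s,0) = 1 and p̃ satisfies the differential equation ∂_t p̃(s,t) = (-bs - Λ + ∑_{j=1}^k λ_j e^{-sj}) p̃(s,t) for all t ≥ 0. -/
noncomputable section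
open MeasureTheory Real Finset

/-- The set Ω(k,n) of k-tuples (x₁,…,x_k) of nonnegative integers with
x₁ + 2x₂ + ⋯ + k x_k = n. -/
def Omega (k n : ℕ) : Finset (Fin k → ℕ) :=
  (Fintype.piFinset fun _ : Fin k => Finset.range (n + 1)).filter
    (fun x => ∑ j, (j.val + 1) * x j = n)

/-- The state probabilities of the generalized counting process:
p(n,t) = ∑_{Ω(k,n)} ∏_j ((λ_j t)^{x_j}/x_j!) e^{-λ_j t}. -/
def gcp (k : ℕ) (l : Fin k → ℝ) (n : ℕ) (t : ℝ) : ℝ :=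
  ∑ x ∈ Omega k n, ∏ j, ((l j * t) ^ (x j) / (Nat.factorial (x j) : ℝ) *
    Real.exp (-(l j * t)))

/-- Product of finitely many absolutely convergent series over `ℕ`. -/
theorem hasSum_pi_prod (k : ℕ) : ∀ (f : Fin k → ℕ → ℝ) (a : Fin k → ℝ),
    (∀ j, Summable fun n => ‖f j n‖) → (∀ j, HasSum (f j) (a j)) →
    (Summable fun x : Fin k → ℕ => ‖∏ j, f j (x j)‖) ∧
      HasSum (fun x : Fin k → ℕ => ∏ j, f j (x j)) (∏ j, a j) := by
  induction k with
  | zero =>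
    intro f a _ _
    refine ⟨(hasSum_fintype _).summable, ?_⟩
    have h := hasSum_fintype (fun x : Fin 0 → ℕ => ∏ j, f j (x j))
    simpa using h
  | succ k ih =>
    intro f a hn hs
    obtain ⟨h1, h2⟩ := ih (fun j => f j.succ) (fun j => a j.succ)
      (fun j => hn j.succ) (fun j => hs j.succ)
    have hsum : Summable fun p : ℕ × (Fin k → ℕ) =>
        ‖f 0 p.1 * ∏ j, f (Fin.succ j) (p.2 j)‖ :=
      Summable.mul_norm (f := f 0) (g := fun x : Fin k → ℕ => ∏ j, f (Fin.succ j) (x j))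
        (hn 0) h1
    have hS : HasSum (fun p : ℕ × (Fin k → ℕ) => f 0 p.1 * ∏ j, f (Fin.succ j) (p.2 j))
        (a 0 * ∏ j, a (Fin.succ j)) := 
      HasSum.mul (f := f 0) (g := fun x : Fin k → ℕ => ∏ j, f (Fin.succ j) (x j))
        (hs 0) h2 hsum.of_norm
    constructor
    · rw [← (Fin.consEquiv (fun _ : Fin (k+1) => ℕ)).summable_iff]
      refine hsum.congr (fun p => ?_)
      simp [Fin.prod_univ_succ, Fin.consEquiv]
    · rw [← (Fin.consEquiv (fun _ : Fin (k+1) => ℕ)).hasSum_iff, Fin.prod_univ_succ]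
      convert hS using 1
      funext p
      simp [Fin.prod_univ_succ, Fin.consEquiv]

theorem gcp_hasSum (k : ℕ) (l : Fin k → ℝ) (s t : ℝ) :
    HasSum (fun n : ℕ => Real.exp (-(s * n)) * gcp k l n t)
      (Real.exp (-t * ∑ j, l j * (1 - Real.exp (-(s * (j.val + 1)))))) := by
  let f : Fin k → ℕ → ℝ := fun j n =>
    ((l j * t * Real.exp (-(s * (j.val + 1)))) ^ n / (Nat.factorial n : ℝ)) *
      Real.exp (-(l j * t))
  let a : Fin k → ℝ := fun j =>
    Real.exp (l j * t * Real.exp (-(s * (j.val + 1)))) * Real.exp (-(l j * t))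
  have hs : ∀ j, HasSum (f j) (a j) := by
    intro j
    have h := NormedSpace.expSeries_div_hasSum_exp (𝔸 := ℝ)
      (l j * t * Real.exp (-(s * (j.val + 1))))
    rw [← Real.exp_eq_exp_ℝ] at h
    exact h.mul_right _
  have hP := (hasSum_pi_prod k f a (fun j => (hs j).summable.norm) hs).2
  have hF := hP.tsum_fiberwise (fun x : Fin k → ℕ => ∑ j, (j.val + 1) * x j)
  have ha : ∏ j, a j = Real.exp (-t * ∑ j, l j * (1 - Real.exp (-(s * (j.val + 1))))) := by
    simp only [a, ← Real.exp_add, ← Real.exp_sum]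
    congr 1
    rw [Finset.mul_sum]
    exact Finset.sum_congr rfl (fun j _ => by ring)
  rw [ha] at hF
  suffices hfun : (fun n : ℕ => Real.exp (-(s * n)) * gcp k l n t) = fun c : ℕ =>
      ∑' b : (fun x : Fin k → ℕ => ∑ j, (j.val + 1) * x j) ⁻¹' {c}, ∏ j, f j (b.1 j) by
    rw [hfun]
    exact hF
  funext n
  have hset : (fun x : Fin k → ℕ => ∑ j, (j.val + 1) * x j) ⁻¹' {n}
      = ((Omega k n : Finset (Fin k → ℕ)) : Set (Fin k → ℕ)) := by
    ext x
    simp only [Set.mem_preimage, Set.mem_singleton_iff, Omega, Finset.coe_filter,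
      Fintype.mem_piFinset, Finset.mem_range, Set.mem_ofPred_eq]
    refine ⟨fun h => ⟨fun j => ?_, h⟩, fun h => h.2⟩
    have h1 := Finset.single_le_sum (f := fun j : Fin k => (j.val + 1) * x j)
      (fun _ _ => Nat.zero_le _) (Finset.mem_univ j)
    simp only [h] at h1
    nlinarith [Nat.zero_le (j.val * x j)]
  rw [hset, Finset.tsum_subtype' (Omega k n) (fun x => ∏ j, f j (x j)), gcp, Finset.mul_sum]
  refine Finset.sum_congr rfl (fun x hx => ?_)
  have hx' : ∑ j, (j.val + 1) * x j = n := (Finset.mem_filter.1 hx).2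
  have he : Real.exp (-(s * n)) = ∏ j, Real.exp (-(s * (j.val + 1))) ^ (x j) := by
    rw [← hx']
    simp only [← Real.exp_nat_mul, ← Real.exp_sum]
    congr 1
    push_cast
    rw [Finset.mul_sum, ← Finset.sum_neg_distrib]
    exact Finset.sum_congr rfl (fun j _ => by ring)
  rw [he, ← Finset.prod_mul_distrib]
  refine Finset.prod_congr rfl (fun j _ => ?_)
  simp only [f]
  rw [mul_pow _ (Real.exp _)]
  ring

theorem gcp_drift_laplace (k : ℕ) (hk : 1 ≤ k) (l : Fin k → ℝ) (hl : ∀ j, 0 < l j)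
    (s b : ℝ) (hs : 0 < s) (hb : 0 ≤ b)
    (Λ : ℝ) (hΛ : Λ = ∑ j, l j)
    (ptilde : ℝ → ℝ)
    (hpt : ∀ t : ℝ, ptilde t =
      Real.exp (-(s * b * t)) * ∑' n : ℕ, Real.exp (-(s * n)) * gcp k l n t) :
    (∀ t : ℝ, 0 ≤ t → ptilde t = Real.exp (-(s * b * t)) *
        Real.exp (-t * ∑ j, l j * (1 - Real.exp (-(s * (j.val + 1)))))) ∧
    ptilde 0 = 1 ∧
    (∀ t : ℝ, 0 ≤ t → HasDerivAt ptilde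
        ((-(b * s) - Λ + ∑ j, l j * Real.exp (-(s * (j.val + 1)))) * ptilde t) t) := by
  have key : ∀ t : ℝ, ptilde t = Real.exp (-(s * b * t)) *
        Real.exp (-t * ∑ j, l j * (1 - Real.exp (-(s * (j.val + 1))))) := by
    intro t
    rw [hpt t, (gcp_hasSum k l s t).tsum_eq]
  refine ⟨fun t _ => key t, by simp [key 0], fun t _ => ?_⟩
  have hC : -(b * s) - Λ + ∑ j, l j * Real.exp (-(s * (j.val + 1)))
      = -(b * s) - ∑ j, l j * (1 - Real.exp (-(s * (j.val + 1)))) := by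
    simp only [mul_sub, mul_one, Finset.sum_sub_distrib, hΛ]
    ring
  rw [hC]
  generalize ∑ j, l j * (1 - Real.exp (-(s * (j.val + 1)))) = S at key ⊢
  have hfun : ptilde = fun t => Real.exp ((-(b * s) - S) * t) := by
    funext u
    rw [key u, ← Real.exp_add]
    congr 1
    ring
  rw [hfun]
  have h := ((hasDerivAt_id t).const_mul (-(b * s) - S)).exp
  simpa [mul_comm] using h
end
end

section
/- For every n ∈ ℕ₀ and t > 0, the function p̂(n,t) satisfies the second-order differential equation d²/dt² p̂(n,t) = 2(Λ p̂(n,t) − ∑_{j=1}^{min(n,k)} λ_j p̂(n−j,t)). -/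
noncomputable section
open MeasureTheory Real Finset

/-- Density of the first-passage time of a standard Brownian motion through level t. -/
def fpt (s t : ℝ) : ℝ := t * Real.exp (-(t ^ 2) / (2 * s)) / Real.sqrt (2 * Real.pi * s ^ 3)

/-- State probabilities of the GCP at Brownian first-passage time:
p̂(n,t) = ∫_0^∞ p(n,s) f(s,t) ds. -/
def phat (k : ℕ) (l : Fin k → ℝ) (n : ℕ) (t : ℝ) : ℝ :=
  ∫ s in Set.Ioi (0 : ℝ), gcp k l n s * fpt s t


lemma mem_Omega {k n : ℕ} {x : Fin k → ℕ} : x ∈ Omega k n ↔ ∑ j, (j.val + 1) * x j = n := by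
  unfold Omega
  simp only [Finset.mem_filter, Fintype.mem_piFinset, Finset.mem_range, and_iff_right_iff_imp]
  intro h j
  have h1 : (j.val + 1) * x j ≤ ∑ j, (j.val + 1) * x j :=
    Finset.single_le_sum (f := fun j : Fin k => (j.val + 1) * x j)
      (fun _ _ => Nat.zero_le _) (Finset.mem_univ j)
  nlinarith [Nat.zero_le (j.val * x j)]

def qf (m : ℕ) (y : ℝ) : ℝ := y ^ m / (Nat.factorial m : ℝ) * Real.exp (-y)

def Qf {k : ℕ} (l : Fin k → ℝ) (x : Fin k → ℕ) (s : ℝ) : ℝ := ∏ j, qf (x j) (l j * s)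

lemma gcp_eq (k : ℕ) (l : Fin k → ℝ) (n : ℕ) (s : ℝ) : gcp k l n s = ∑ x ∈ Omega k n, Qf l x s :=
  rfl

lemma qf_deriv (m : ℕ) (y : ℝ) :
    HasDerivAt (qf m) ((if 1 ≤ m then qf (m - 1) y else 0) - qf m y) y := by
  unfold qf
  have he : HasDerivAt (fun y : ℝ => Real.exp (-y)) (-Real.exp (-y)) y := by
    simpa using (hasDerivAt_neg y).exp
  have h := ((hasDerivAt_pow m y).div_const (Nat.factorial m : ℝ)).mul he
  refine h.congr_deriv ?_
  cases m with
  | zero => simp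
  | succ m =>
    have : (Nat.factorial m : ℝ) ≠ 0 := by positivity
    have h2 : (m : ℝ) + 1 ≠ 0 := by positivity
    simp [Nat.factorial_succ]
    field_simp
    ring

lemma qf_nonneg (m : ℕ) {y : ℝ} (hy : 0 ≤ y) : 0 ≤ qf m y := by
  unfold qf; positivity

lemma qf_le_one (m : ℕ) {y : ℝ} (hy : 0 ≤ y) : qf m y ≤ 1 := by
  unfold qf
  rw [Real.exp_neg, ← div_eq_mul_inv, div_le_one (Real.exp_pos _)]
  exact Real.pow_div_factorial_le_exp y hy m

lemma Qf_deriv {k : ℕ} (l : Fin k → ℝ) (x : Fin k → ℕ) (s : ℝ) :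
    HasDerivAt (Qf l x)
      (∑ j, l j * ((if 1 ≤ x j then Qf l (Function.update x j (x j - 1)) s else 0) - Qf l x s)) s := by
  unfold Qf
  have h : ∀ j ∈ (Finset.univ : Finset (Fin k)), HasDerivAt (fun s => qf (x j) (l j * s))
      (((if 1 ≤ x j then qf (x j - 1) (l j * s) else 0) - qf (x j) (l j * s)) * l j) s := by
    intro j _
    have h1 : HasDerivAt (fun s => l j * s) (l j) s := by
      simpa using (hasDerivAt_id s).const_mul (l j)
    exact (qf_deriv (x j) (l j * s)).comp s h1
  refine (HasDerivAt.fun_finsetProd h).congr_deriv ?_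
  refine Finset.sum_congr rfl fun j _ => ?_
  have e1 : ∏ i, qf (x i) (l i * s) =
      (∏ i ∈ Finset.univ.erase j, qf (x i) (l i * s)) * qf (x j) (l j * s) :=
    (Finset.prod_erase_mul _ _ (Finset.mem_univ j)).symm
  have e2 : ∏ i, qf (Function.update x j (x j - 1) i) (l i * s) =
      (∏ i ∈ Finset.univ.erase j, qf (x i) (l i * s)) * qf (x j - 1) (l j * s) := by
    rw [← Finset.prod_erase_mul _ _ (Finset.mem_univ j)]
    congr 1
    · refine Finset.prod_congr rfl fun i hi => ?_
      rw [Function.update_of_ne (Finset.ne_of_mem_erase hi)]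
    · rw [Function.update_self]
  rw [e1, e2, smul_eq_mul]
  split_ifs <;> ring

lemma sum_update {k : ℕ} (x : Fin k → ℕ) (j : Fin k) (v : ℕ) :
    ∑ i, (i.val + 1) * Function.update x j v i + (j.val + 1) * x j
      = ∑ i, (i.val + 1) * x i + (j.val + 1) * v := by
  rw [← Finset.sum_erase_add _ _ (Finset.mem_univ j),
    ← Finset.sum_erase_add _ (fun i : Fin k => (i.val + 1) * x i) (Finset.mem_univ j)]
  have : ∑ i ∈ Finset.univ.erase j, (i.val + 1) * Function.update x j v i
      = ∑ i ∈ Finset.univ.erase j, (i.val + 1) * x i := by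
    refine Finset.sum_congr rfl fun i hi => ?_
    rw [Function.update_of_ne (Finset.ne_of_mem_erase hi)]
  rw [this, Function.update_self]; ring

lemma shift_sum {k : ℕ} (l : Fin k → ℝ) (n : ℕ) (j : Fin k) (s : ℝ) :
    ∑ x ∈ Omega k n, (if 1 ≤ x j then Qf l (Function.update x j (x j - 1)) s else 0)
      = if j.val + 1 ≤ n then gcp k l (n - (j.val + 1)) s else 0 := by
  rw [← Finset.sum_filter]
  split_ifs with hn
  · rw [gcp_eq]
    refine Finset.sum_nbij' (fun x => Function.update x j (x j - 1))
      (fun x => Function.update x j (x j + 1)) ?_ ?_ ?_ ?_ ?_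
    · intro x hx
      rw [Finset.mem_filter, mem_Omega] at hx
      rw [mem_Omega]
      have := sum_update x j (x j - 1)
      obtain ⟨m, hm⟩ : ∃ m, x j = m + 1 := ⟨x j - 1, by omega⟩
      rw [hx.1, hm] at this
      rw [hm]
      simp only [Nat.add_sub_cancel] at this ⊢
      rw [mul_add] at this
      omega
    · intro x hx
      rw [mem_Omega] at hx
      rw [Finset.mem_filter, mem_Omega]
      have := sum_update x j (x j + 1)
      rw [hx, mul_add] at this
      refine ⟨by omega, by simp⟩
    · intro x hx
      rw [Finset.mem_filter] at hx
      have : x j - 1 + 1 = x j := by omega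
      simp [this]
    · intro x hx
      simp
    · intro x hx; rfl
  · refine Finset.sum_eq_zero fun x hx => ?_
    exfalso
    rw [Finset.mem_filter, mem_Omega] at hx
    have h1 : (j.val + 1) * x j ≤ ∑ j, (j.val + 1) * x j :=
      Finset.single_le_sum (f := fun j : Fin k => (j.val + 1) * x j)
        (fun _ _ => Nat.zero_le _) (Finset.mem_univ j)
    have := Nat.mul_le_mul_left (j.val + 1) hx.2
    omega

lemma gcp_deriv (k : ℕ) (l : Fin k → ℝ) (n : ℕ) (s : ℝ) :
    HasDerivAt (gcp k l n)
      ((∑ j : Fin k, if j.val + 1 ≤ n then l j * gcp k l (n - (j.val + 1)) s else 0)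
        - (∑ j, l j) * gcp k l n s) s := by
  have h : HasDerivAt (fun s => ∑ x ∈ Omega k n, Qf l x s) _ s :=
    HasDerivAt.fun_sum (fun x _ => Qf_deriv l x s)
  refine h.congr_deriv ?_
  rw [Finset.sum_comm, Finset.sum_mul, ← Finset.sum_sub_distrib]
  refine Finset.sum_congr rfl fun j _ => ?_
  rw [← Finset.mul_sum, Finset.sum_sub_distrib, shift_sum, gcp_eq k l n]
  split_ifs <;> ring

lemma gcp_cont (k : ℕ) (l : Fin k → ℝ) (n : ℕ) : Continuous (gcp k l n) :=
  continuous_iff_continuousAt.2 fun s => (gcp_deriv k l n s).continuousAt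

lemma gcp_bound (k : ℕ) (l : Fin k → ℝ) (hl : ∀ j, 0 < l j) (n : ℕ) {s : ℝ} (hs : 0 ≤ s) :
    |gcp k l n s| ≤ (Omega k n).card := by
  rw [gcp_eq]
  have h0 : ∀ x, 0 ≤ Qf l x s := fun x =>
    Finset.prod_nonneg fun j _ => qf_nonneg _ (mul_nonneg (hl j).le hs)
  rw [abs_of_nonneg (Finset.sum_nonneg fun x _ => h0 x)]
  calc _ ≤ ∑ x ∈ Omega k n, (1 : ℝ) := Finset.sum_le_sum fun x _ =>
        Finset.prod_le_one (fun j _ => qf_nonneg _ (mul_nonneg (hl j).le hs))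
          (fun j _ => qf_le_one _ (mul_nonneg (hl j).le hs))
    _ = _ := by simp

open Filter Topology

def Kf (b s : ℝ) : ℝ := Real.exp (-b / s) / Real.sqrt (2 * Real.pi * s ^ 3)

lemma fpt_eq (s t : ℝ) : fpt s t = t * Kf (t ^ 2 / 2) s := by
  unfold fpt Kf
  rw [show -(t ^ 2 / 2) / s = -(t ^ 2) / (2 * s) by rw [← neg_div, div_div]]
  ring

def F1 (s t : ℝ) : ℝ := (1 - t ^ 2 / s) * Kf (t ^ 2 / 2) s
def F2 (s t : ℝ) : ℝ := (t ^ 3 / s ^ 2 - 3 * t / s) * Kf (t ^ 2 / 2) s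

lemma Kf_nonneg (b s : ℝ) : 0 ≤ Kf b s := by unfold Kf; positivity

lemma Kf_meas (b : ℝ) : Measurable (Kf b) := by unfold Kf; fun_prop

lemma exp_bound (m : ℕ) {b s : ℝ} (hb : 0 < b) (hs : 0 < s) :
    Real.exp (-b / s) / s ^ m ≤ (Nat.factorial m : ℝ) / b ^ m := by
  have h := Real.pow_div_factorial_le_exp (b / s) (by positivity) m
  rw [neg_div, Real.exp_neg, div_le_div_iff₀ (by positivity) (by positivity)]
  rw [div_le_iff₀ (by positivity), div_pow, div_le_iff₀ (by positivity)] at h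
  rw [inv_mul_le_iff₀ (by positivity)]
  linarith

lemma Kf_shift (m : ℕ) {a t s : ℝ} (ha : 0 < a) (hat : a ≤ t) (hs : 0 < s) :
    Kf (t ^ 2 / 2) s / s ^ m ≤ (Nat.factorial m : ℝ) / (a ^ 2 / 4) ^ m * Kf (a ^ 2 / 4) s := by
  have h := exp_bound m (b := a ^ 2 / 4) (by positivity) hs
  have h2 : Real.exp (-(t ^ 2 / 2) / s) ≤ Real.exp (-(a ^ 2 / 4) / s) * Real.exp (-(a ^ 2 / 4) / s) := by
    rw [← Real.exp_add]
    apply Real.exp_le_exp.2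
    rw [← add_div]
    gcongr
    nlinarith
  unfold Kf
  calc _ ≤ (Real.exp (-(a ^ 2 / 4) / s) * Real.exp (-(a ^ 2 / 4) / s))
        / Real.sqrt (2 * Real.pi * s ^ 3) / s ^ m := by gcongr
    _ = (Real.exp (-(a ^ 2 / 4) / s) / s ^ m) *
        (Real.exp (-(a ^ 2 / 4) / s) / Real.sqrt (2 * Real.pi * s ^ 3)) := by ring
    _ ≤ _ := by gcongr

lemma sqrt_low {s : ℝ} (hs : 0 < s) : s * Real.sqrt s ≤ Real.sqrt (2 * Real.pi * s ^ 3) := by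
  apply Real.le_sqrt_of_sq_le
  rw [mul_pow, Real.sq_sqrt hs.le]
  have := Real.pi_gt_three
  have h3 : 0 < s ^ 3 := by positivity
  nlinarith

lemma Kf_small {b s : ℝ} (hb : 0 < b) (hs : 0 < s) : Kf b s ≤ 2 / b ^ 2 * Real.sqrt s := by
  have h := exp_bound 2 hb hs
  have h0 := Real.sqrt_pos.2 hs
  unfold Kf
  calc _ ≤ Real.exp (-b / s) / (s * Real.sqrt s) := by
        gcongr; exact sqrt_low hs
    _ = Real.exp (-b / s) / s ^ 2 * Real.sqrt s := by
        have := Real.sq_sqrt hs.le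
        field_simp
        rw [this]
    _ ≤ _ := by
        refine mul_le_mul_of_nonneg_right ?_ h0.le
        simpa using h

lemma Kf_large {b s : ℝ} (hb : 0 < b) (hs : 0 < s) : Kf b s ≤ s ^ (-(3/2) : ℝ) := by
  have h0 := Real.sqrt_pos.2 hs
  have : s ^ (-(3/2) : ℝ) = 1 / (s * Real.sqrt s) := by
    rw [Real.rpow_neg hs.le, show (3/2 : ℝ) = 1 + 1/2 by norm_num, Real.rpow_add hs,
      Real.rpow_one, ← Real.sqrt_eq_rpow, one_div]
  rw [this]
  unfold Kf
  have h1 : Real.exp (-b / s) ≤ 1 := by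
    apply Real.exp_le_one_iff.2
    rw [neg_div]
    have : 0 < b / s := by positivity
    linarith
  gcongr
  exact sqrt_low hs

lemma Kf_int {b : ℝ} (hb : 0 < b) : IntegrableOn (Kf b) (Set.Ioi 0) := by
  rw [← Set.Ioc_union_Ioi_eq_Ioi (zero_le_one (α := ℝ))]
  refine IntegrableOn.union ?_ ?_
  · have hc : IntegrableOn (fun _ : ℝ => 2 / b ^ 2) (Set.Ioc 0 1) := by
      simp
    refine Integrable.mono' hc (Kf_meas b).aestronglyMeasurable ?_
    refine (ae_restrict_iff' measurableSet_Ioc).2 (ae_of_all _ fun s hs => ?_)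
    rw [Real.norm_of_nonneg (Kf_nonneg b s)]
    refine (Kf_small hb hs.1).trans ?_
    have : Real.sqrt s ≤ 1 := Real.sqrt_le_one.2 hs.2
    exact mul_le_of_le_one_right (by positivity) this
  · have hc := integrableOn_Ioi_rpow_of_lt (a := -(3/2)) (by norm_num) (zero_lt_one (α := ℝ))
    refine Integrable.mono' hc (Kf_meas b).aestronglyMeasurable ?_
    refine (ae_restrict_iff' measurableSet_Ioi).2 (ae_of_all _ fun s hs => ?_)
    rw [Real.norm_of_nonneg (Kf_nonneg b s)]
    exact Kf_large hb (zero_lt_one.trans hs)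

lemma Kf_deriv_t {s : ℝ} (hs : 0 < s) (t : ℝ) :
    HasDerivAt (fun t => Kf (t ^ 2 / 2) s) (-(t / s) * Kf (t ^ 2 / 2) s) t := by
  unfold Kf
  have h1 : HasDerivAt (fun t : ℝ => -(t ^ 2 / 2) / s) (-(t / s)) t := by
    refine (((hasDerivAt_pow 2 t).div_const 2).neg.div_const s).congr_deriv ?_
    norm_num
    ring
  refine (h1.exp.div_const _).congr_deriv ?_
  ring

lemma fpt_deriv_t {s : ℝ} (hs : 0 < s) (t : ℝ) : HasDerivAt (fun t => fpt s t) (F1 s t) t := by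
  simp_rw [fpt_eq]
  refine ((hasDerivAt_id t).mul (Kf_deriv_t hs t)).congr_deriv ?_
  unfold F1; simp only [id]; ring

lemma F1_deriv_t {s : ℝ} (hs : 0 < s) (t : ℝ) : HasDerivAt (fun t => F1 s t) (F2 s t) t := by
  unfold F1
  have h : HasDerivAt (fun t : ℝ => 1 - t ^ 2 / s) (-(2 * t / s)) t := by
    refine (((hasDerivAt_pow 2 t).div_const s).const_sub 1).congr_deriv ?_
    norm_num
  refine (h.mul (Kf_deriv_t hs t)).congr_deriv ?_
  unfold F2; ring

lemma fpt_deriv_s {s : ℝ} (hs : 0 < s) (t : ℝ) :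
    HasDerivAt (fun s => fpt s t) (F2 s t / 2) s := by
  simp_rw [fpt_eq]
  unfold F2 Kf
  have hp : 0 < 2 * Real.pi * s ^ 3 := by positivity
  have h1 : HasDerivAt (fun s : ℝ => -(t ^ 2 / 2) / s) (t ^ 2 / 2 / s ^ 2) s := by
    refine ((hasDerivAt_inv hs.ne').const_mul (-(t ^ 2 / 2))).congr_deriv ?_
    ring
  have h2 : HasDerivAt (fun s : ℝ => Real.sqrt (2 * Real.pi * s ^ 3))
      (2 * Real.pi * (3 * s ^ 2) / (2 * Real.sqrt (2 * Real.pi * s ^ 3))) s := by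
    refine (((hasDerivAt_pow 3 s).const_mul (2 * Real.pi)).sqrt hp.ne').congr_deriv ?_
    norm_num
  have hr := Real.sqrt_pos.2 hp
  refine ((h1.exp.div h2 hr.ne').const_mul t).congr_deriv ?_
  have hsq := Real.sq_sqrt hp.le
  set r := Real.sqrt (2 * Real.pi * s ^ 3)
  set e := Real.exp (-(t ^ 2 / 2) / s)
  have e1 : 2 * Real.pi * (3 * s ^ 2) / (2 * r) = 3 / 2 * r / s := by
    field_simp
    rw [hsq]
  rw [e1]
  field_simp

lemma bounds {t0 : ℝ} (ht : 0 < t0) : ∃ C : ℝ, ∀ s, 0 < s → ∀ t ∈ Set.Ioo (t0 / 2) (2 * t0),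
    |fpt s t| ≤ C * Kf ((t0 / 2) ^ 2 / 4) s ∧ |F1 s t| ≤ C * Kf ((t0 / 2) ^ 2 / 4) s ∧
    |F2 s t| ≤ C * Kf ((t0 / 2) ^ 2 / 4) s := by
  set a := t0 / 2 with ha
  have ha0 : 0 < a := by positivity
  set c : ℕ → ℝ := fun m => (Nat.factorial m : ℝ) / (a ^ 2 / 4) ^ m with hc
  have hcp : ∀ m, 0 < c m := fun m => by simp only [hc]; positivity
  set T := 2 * t0 with hT
  have hT0 : 0 < T := by positivity
  refine ⟨T * c 0 + (c 0 + T ^ 2 * c 1) + (T ^ 3 * c 2 + 3 * T * c 1), fun s hs t htt => ?_⟩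
  have ht0 : 0 < t := ha0.trans htt.1
  have hk : ∀ m, Kf (t ^ 2 / 2) s / s ^ m ≤ c m * Kf (a ^ 2 / 4) s :=
    fun m => Kf_shift m ha0 htt.1.le hs
  set K := Kf (a ^ 2 / 4) s
  have hK : 0 ≤ K := Kf_nonneg _ _
  set k := Kf (t ^ 2 / 2) s with hkd
  have hk0 : 0 ≤ k := Kf_nonneg _ _
  have h0 : k ≤ c 0 * K := by simpa using hk 0
  have h1 : k / s ≤ c 1 * K := by simpa using hk 1
  have h2 := hk 2
  have p0 := mul_nonneg (hcp 0).le hK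
  have p1 := mul_nonneg (hcp 1).le hK
  have p2 := mul_nonneg (hcp 2).le hK
  have b0 : |fpt s t| ≤ T * (c 0 * K) := by
    rw [fpt_eq, abs_of_nonneg (by positivity)]
    have := htt.2.le
    gcongr
  have b1 : |F1 s t| ≤ c 0 * K + T ^ 2 * (c 1 * K) := by
    have : F1 s t = k - t ^ 2 * (k / s) := by unfold F1; ring
    rw [this]
    refine (abs_sub _ _).trans ?_
    rw [abs_of_nonneg hk0, abs_of_nonneg (by positivity)]
    have := htt.2.le
    gcongr
  have b2 : |F2 s t| ≤ T ^ 3 * (c 2 * K) + 3 * T * (c 1 * K) := by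
    have : F2 s t = t ^ 3 * (k / s ^ 2) - 3 * t * (k / s) := by unfold F2; ring
    rw [this]
    refine (abs_sub _ _).trans ?_
    rw [abs_of_nonneg (by positivity), abs_of_nonneg (by positivity)]
    have := htt.2.le
    gcongr
  have q0 := mul_nonneg hT0.le p0
  have q1 := mul_nonneg (pow_nonneg hT0.le 2) p1
  have q2 := mul_nonneg (pow_nonneg hT0.le 3) p2
  have q3 := mul_nonneg hT0.le p1
  refine ⟨?_, ?_, ?_⟩ <;> nlinarith

lemma fpt_meas (t : ℝ) : Measurable (fun s => fpt s t) := by unfold fpt; fun_prop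
lemma F1_meas (t : ℝ) : Measurable (fun s => F1 s t) := by
  have := Kf_meas (t ^ 2 / 2)
  unfold F1; fun_prop
lemma F2_meas (t : ℝ) : Measurable (fun s => F2 s t) := by
  have := Kf_meas (t ^ 2 / 2)
  unfold F2; fun_prop

lemma int_of_bound {g h : ℝ → ℝ} (hg : Continuous g) {N C b : ℝ}
    (hN : ∀ s, 0 ≤ s → |g s| ≤ N) (hh : Measurable h) (hb : 0 < b)
    (hC : ∀ s, 0 < s → |h s| ≤ C * Kf b s) :
    IntegrableOn (fun s => g s * h s) (Set.Ioi 0) := by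
  refine Integrable.mono' (((Kf_int hb).const_mul C).const_mul N)
    (hg.measurable.mul hh).aestronglyMeasurable ?_
  refine (ae_restrict_iff' measurableSet_Ioi).2 (ae_of_all _ fun s hs => ?_)
  rw [Real.norm_eq_abs, abs_mul]
  exact mul_le_mul (hN s (le_of_lt hs)) (hC s hs) (abs_nonneg _)
    ((abs_nonneg _).trans (hN s (le_of_lt hs)))

lemma diff_int {g : ℝ → ℝ} (hg : Continuous g) {N C b t0 : ℝ} (ht : 0 < t0)
    (hN : ∀ s, 0 ≤ s → |g s| ≤ N) (F F' : ℝ → ℝ → ℝ)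
    (hF : ∀ t, Measurable (fun s => F s t)) (hF' : ∀ t, Measurable (fun s => F' s t))
    (hb : 0 < b)
    (hC : ∀ s, 0 < s → ∀ t ∈ Set.Ioo (t0 / 2) (2 * t0), |F s t| ≤ C * Kf b s)
    (hC' : ∀ s, 0 < s → ∀ t ∈ Set.Ioo (t0 / 2) (2 * t0), |F' s t| ≤ C * Kf b s)
    (hd : ∀ s, 0 < s → ∀ t, HasDerivAt (fun t => F s t) (F' s t) t) :
    HasDerivAt (fun t => ∫ s in Set.Ioi (0 : ℝ), g s * F s t)
      (∫ s in Set.Ioi (0 : ℝ), g s * F' s t0) t0 := by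
  have hmem : t0 ∈ Set.Ioo (t0 / 2) (2 * t0) := ⟨by linarith, by linarith⟩
  refine (hasDerivAt_integral_of_dominated_loc_of_deriv_le
    (F := fun t s => g s * F s t) (F' := fun t s => g s * F' s t)
    (bound := fun s => N * (C * Kf b s)) (Ioo_mem_nhds hmem.1 hmem.2) ?_ ?_ ?_ ?_ ?_ ?_).2
  · exact Eventually.of_forall fun t => (hg.measurable.mul (hF t)).aestronglyMeasurable
  · exact int_of_bound hg hN (hF t0) hb (fun s hs => hC s hs t0 hmem)
  · exact (hg.measurable.mul (hF' t0)).aestronglyMeasurable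
  · refine (ae_restrict_iff' measurableSet_Ioi).2 (ae_of_all _ fun s hs t htt => ?_)
    rw [Real.norm_eq_abs, abs_mul]
    exact mul_le_mul (hN s (le_of_lt hs)) (hC' s hs t htt) (abs_nonneg _)
      ((abs_nonneg _).trans (hN s (le_of_lt hs)))
  · exact ((Kf_int hb).const_mul C).const_mul N
  · refine (ae_restrict_iff' measurableSet_Ioi).2 (ae_of_all _ fun s hs t htt => ?_)
    exact (hd s hs t).const_mul (g s)

lemma phat_int (k : ℕ) (l : Fin k → ℝ) (hl : ∀ j, 0 < l j) (n : ℕ) {t : ℝ} (ht : 0 < t) :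
    IntegrableOn (fun s => gcp k l n s * fpt s t) (Set.Ioi 0) := by
  obtain ⟨C, hC⟩ := bounds ht
  exact int_of_bound (gcp_cont k l n) (fun s hs => gcp_bound k l hl n hs) (fpt_meas t)
    (b := (t / 2) ^ 2 / 4) (by positivity)
    (fun s hs => (hC s hs t ⟨by linarith, by linarith⟩).1)

lemma phat_deriv (k : ℕ) (l : Fin k → ℝ) (hl : ∀ j, 0 < l j) (n : ℕ) {t : ℝ} (ht : 0 < t) :
    HasDerivAt (phat k l n) (∫ s in Set.Ioi (0 : ℝ), gcp k l n s * F1 s t) t := by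
  obtain ⟨C, hC⟩ := bounds ht
  exact diff_int (gcp_cont k l n) ht (fun s hs => gcp_bound k l hl n hs) fpt F1 fpt_meas F1_meas
    (b := (t / 2) ^ 2 / 4) (by positivity) (fun s hs u hu => (hC s hs u hu).1)
    (fun s hs u hu => (hC s hs u hu).2.1) (fun s hs u => fpt_deriv_t hs u)

lemma phat_deriv2 (k : ℕ) (l : Fin k → ℝ) (hl : ∀ j, 0 < l j) (n : ℕ) {t : ℝ} (ht : 0 < t) :
    HasDerivAt (deriv (phat k l n)) (∫ s in Set.Ioi (0 : ℝ), gcp k l n s * F2 s t) t := by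
  obtain ⟨C, hC⟩ := bounds ht
  have h := diff_int (gcp_cont k l n) ht (fun s hs => gcp_bound k l hl n hs) F1 F2 F1_meas F2_meas
    (b := (t / 2) ^ 2 / 4) (by positivity) (fun s hs u hu => (hC s hs u hu).2.1)
    (fun s hs u hu => (hC s hs u hu).2.2) (fun s hs u => F1_deriv_t hs u)
  refine h.congr_of_eventuallyEq ?_
  filter_upwards [Ioi_mem_nhds ht] with u hu
  exact (phat_deriv k l hl n hu).deriv

lemma tendsto_zero_left (k : ℕ) (l : Fin k → ℝ) (hl : ∀ j, 0 < l j) (n : ℕ) {t : ℝ} (ht : 0 < t) :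
    Tendsto (fun s => gcp k l n s * fpt s t) (𝓝[>] 0) (𝓝 0) := by
  have hlim : Tendsto (fun s => ((Omega k n).card : ℝ) * (t * (2 / (t ^ 2 / 2) ^ 2 * Real.sqrt s)))
      (𝓝[>] 0) (𝓝 0) := by
    have : Continuous (fun s => ((Omega k n).card : ℝ) *
        (t * (2 / (t ^ 2 / 2) ^ 2 * Real.sqrt s))) := by fun_prop
    have h := this.tendsto 0
    simp only [Real.sqrt_zero, mul_zero] at h
    exact h.mono_left nhdsWithin_le_nhds
  refine squeeze_zero_norm' ?_ hlim
  filter_upwards [self_mem_nhdsWithin] with s hs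
  have hs : 0 < s := hs
  rw [Real.norm_eq_abs, abs_mul, fpt_eq, abs_of_nonneg (mul_nonneg ht.le (Kf_nonneg _ _))]
  have := Kf_small (b := t ^ 2 / 2) (by positivity) hs
  have h2 := gcp_bound k l hl n hs.le
  have := Kf_nonneg (t ^ 2 / 2) s
  gcongr

theorem gcp_fpt_ode (k : ℕ) (hk : 1 ≤ k) (l : Fin k → ℝ) (hl : ∀ j, 0 < l j)
    (n : ℕ) (t : ℝ) (ht : 0 < t) :
    deriv (deriv (phat k l n)) t =
      2 * ((∑ j, l j) * phat k l n t -
        ∑ j : Fin k, if j.val + 1 ≤ n then l j * phat k l (n - (j.val + 1)) t else 0) := by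

  obtain ⟨C, hC⟩ := bounds ht
  rw [(phat_deriv2 k l hl n ht).deriv]
  have hF2 : IntegrableOn (fun s => gcp k l n s * F2 s t) (Set.Ioi 0) :=
    int_of_bound (gcp_cont k l n) (fun s hs => gcp_bound k l hl n hs) (F2_meas t)
      (b := (t / 2) ^ 2 / 4) (by positivity)
      (fun s hs => (hC s hs t ⟨by linarith, by linarith⟩).2.2)
  have hterm : ∀ j : Fin k, IntegrableOn (fun s => if j.val + 1 ≤ n then
      l j * (gcp k l (n - (j.val + 1)) s * fpt s t) else 0) (Set.Ioi 0) := by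
    intro j
    split_ifs
    · exact (phat_int k l hl _ ht).const_mul _
    · exact integrableOn_zero
  have hsum : IntegrableOn (fun s => ∑ j : Fin k, if j.val + 1 ≤ n then
      l j * (gcp k l (n - (j.val + 1)) s * fpt s t) else 0) (Set.Ioi 0) :=
    integrable_finsetSum _ fun j _ => hterm j
  have hself := (phat_int k l hl n ht).const_mul (∑ j, l j)
  have hfun : (fun s => ((∑ j : Fin k, if j.val + 1 ≤ n then l j * gcp k l (n - (j.val + 1)) s else 0)
        - (∑ j, l j) * gcp k l n s) * fpt s t) = fun s => (∑ j : Fin k, if j.val + 1 ≤ n then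
      l j * (gcp k l (n - (j.val + 1)) s * fpt s t) else 0)
        - (∑ j, l j) * (gcp k l n s * fpt s t) := by
    funext s
    rw [sub_mul, Finset.sum_mul, mul_assoc]
    congr 1
    refine Finset.sum_congr rfl fun j _ => ?_
    split_ifs <;> ring
  have hu'v : IntegrableOn (fun s => ((∑ j : Fin k, if j.val + 1 ≤ n then
      l j * gcp k l (n - (j.val + 1)) s else 0) - (∑ j, l j) * gcp k l n s) * fpt s t)
      (Set.Ioi 0) := by
    rw [hfun]; exact hsum.sub hself
  have huv' : IntegrableOn (fun s => gcp k l n s * (F2 s t / 2)) (Set.Ioi 0) := by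
    refine (hF2.div_const 2).congr (ae_of_all _ fun s => ?_)
    simp only []
    ring
  have hinf : Tendsto (fun s => gcp k l n s * fpt s t) atTop (𝓝 0) :=
    tendsto_zero_of_hasDerivAt_of_integrableOn_Ioi (a := 0)
      (fun s hs => (gcp_deriv k l n s).mul (fpt_deriv_s hs t))
      (hu'v.add huv') (phat_int k l hl n ht)
  have key := integral_Ioi_mul_deriv_eq_deriv_mul (a := 0) (u := gcp k l n)
    (v := fun s => fpt s t) (fun s _ => gcp_deriv k l n s) (fun s hs => fpt_deriv_s hs t)
    huv' hu'v (tendsto_zero_left k l hl n ht) hinf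
  have e1 : ∫ s in Set.Ioi (0 : ℝ), gcp k l n s * F2 s t
      = 2 * ∫ s in Set.Ioi (0 : ℝ), gcp k l n s * (F2 s t / 2) := by
    rw [← integral_const_mul]
    congr 1; funext s; ring
  rw [e1, key, hfun, integral_sub hsum hself, integral_const_mul,
    integral_finsetSum _ fun j _ => hterm j]
  have e2 : ∀ j : Fin k, (∫ s in Set.Ioi (0 : ℝ), if j.val + 1 ≤ n then
      l j * (gcp k l (n - (j.val + 1)) s * fpt s t) else 0)
      = if j.val + 1 ≤ n then l j * phat k l (n - (j.val + 1)) t else 0 := by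
    intro j
    split_ifs
    · rw [integral_const_mul]; rfl
    · simp
  simp_rw [e2]
  unfold phat
  ring
end
end

section
/- For every n ∈ ℕ₀ and t > 0, p̂(n,t) = ∑_{Ω(k,n)} (∏_{j=1}^k λ_j^{x_j}/x_j!) · (t^{z_k + 1/2} Λ^{1/4 − z_k/2} 2^{3/4 − z_k/2}/√π) · K_{z_k − 1/2}(t√(2Λ)), where z_k = x_1 + x_2 + ⋯ + x_k. -/
noncomputable section
open MeasureTheory Real Finset

/-- The modified Bessel function of index α:
K_α(s) = (1/2)(s/2)^α ∫_0^∞ e^{-u - s²/(4u)} u^{-α-1} du. -/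
def besselK (α s : ℝ) : ℝ :=
  (1 / 2) * (s / 2) ^ α * ∫ u in Set.Ioi (0 : ℝ), Real.exp (-u - s ^ 2 / (4 * u)) * u ^ (-α - 1)


lemma aux_integrable (z : ℕ) (Λ t : ℝ) (hΛ : 0 < Λ) (ht : 0 < t) :
    IntegrableOn (fun s : ℝ => s ^ ((z : ℝ) - 3 / 2) * Real.exp (-(Λ * s)) *
      Real.exp (-(t ^ 2) / (2 * s))) (Set.Ioi 0) := by
  have h := integrableOn_rpow_mul_exp_neg_mul_rpow (p := 1) (s := (z : ℝ) - 1 / 2) (b := Λ)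
    (by have : (0 : ℝ) ≤ z := Nat.cast_nonneg z
        linarith) (by norm_num) hΛ
  have h2 := h.const_mul (2 / t ^ 2)
  refine Integrable.mono' h2 ?_ ?_
  · exact Measurable.aestronglyMeasurable (by fun_prop)
  · refine (ae_restrict_iff' measurableSet_Ioi).2 (Filter.Eventually.of_forall fun s hs => ?_)
    have hs : 0 < s := hs
    rw [Real.norm_of_nonneg (by positivity)]
    have e1 : s ^ ((z : ℝ) - 1 / 2) = s ^ ((z : ℝ) - 3 / 2) * s := by
      rw [← Real.rpow_add_one hs.ne']
      congr 1
      ring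
    have e2 : Real.exp (-(t ^ 2) / (2 * s)) ≤ 2 / t ^ 2 * s := by
      have h3 : t ^ 2 / (2 * s) ≤ Real.exp (t ^ 2 / (2 * s)) := by
        have := Real.add_one_le_exp (t ^ 2 / (2 * s))
        linarith
      rw [neg_div, Real.exp_neg]
      calc _ ≤ (t ^ 2 / (2 * s))⁻¹ := inv_anti₀ (by positivity) h3
        _ = _ := by field_simp
    simp only [Real.rpow_one]
    rw [e1, neg_mul]
    calc _ ≤ s ^ ((z : ℝ) - 3 / 2) * Real.exp (-(Λ * s)) * (2 / t ^ 2 * s) := by gcongr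
      _ = _ := by ring

lemma aux_subst (g : ℝ → ℝ) (c : ℝ) (hc : 0 < c) :
    ∫ s in Set.Ioi (0 : ℝ), g s = ∫ u in Set.Ioi (0 : ℝ), c * u ^ (-2 : ℝ) * g (c * u⁻¹) := by
  have h1 := integral_comp_mul_left_Ioi g 0 hc
  have h2 := integral_comp_rpow_Ioi (fun x => g (c * x)) (p := -1) (by norm_num)
  rw [mul_zero] at h1
  have h3 : ∫ s in Set.Ioi (0 : ℝ), g s = c * ∫ x in Set.Ioi (0 : ℝ), g (c * x) := by
    rw [h1, smul_eq_mul]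
    field_simp
  rw [h3, ← h2, ← integral_const_mul]
  refine setIntegral_congr_fun measurableSet_Ioi fun u hu => ?_
  have hu : 0 < u := hu
  simp only [smul_eq_mul, Real.rpow_neg_one]
  norm_num
  ring

lemma aux_integral (z : ℕ) (Λ t : ℝ) (hΛ : 0 < Λ) (ht : 0 < t) :
    ∫ s in Set.Ioi (0 : ℝ), s ^ ((z : ℝ) - 3 / 2) * Real.exp (-(Λ * s)) *
      Real.exp (-(t ^ 2) / (2 * s)) =
    (t ^ 2 / 2) ^ ((z : ℝ) - 1 / 2) * ∫ u in Set.Ioi (0 : ℝ),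
      Real.exp (-u - (t * Real.sqrt (2 * Λ)) ^ 2 / (4 * u)) * u ^ (-((z : ℝ) - 1 / 2) - 1) := by
  rw [aux_subst _ (t ^ 2 / 2) (by positivity), ← integral_const_mul]
  refine setIntegral_congr_fun measurableSet_Ioi fun u hu => ?_
  have hu : 0 < u := hu
  have hc : 0 < t ^ 2 / 2 := by positivity
  rw [Real.mul_rpow hc.le (by positivity), Real.inv_rpow hu.le, ← Real.rpow_neg hu.le,
    mul_assoc (_ * _) (Real.exp _), ← Real.exp_add, mul_pow, Real.sq_sqrt (by positivity)]
  have e1 : -(Λ * (t ^ 2 / 2 * u⁻¹)) + -t ^ 2 / (2 * (t ^ 2 / 2 * u⁻¹)) =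
      -u - t ^ 2 * (2 * Λ) / (4 * u) := by
    field_simp
    ring
  have e2 : (t ^ 2 / 2) ^ ((z : ℝ) - 1 / 2) = (t ^ 2 / 2) ^ ((z : ℝ) - 3 / 2) * (t ^ 2 / 2) := by
    rw [← Real.rpow_add_one hc.ne']
    congr 1
    ring
  have e3 : u ^ (-((z : ℝ) - 1 / 2) - 1) = u ^ (-2 : ℝ) * u ^ (-((z : ℝ) - 3 / 2)) := by
    rw [← Real.rpow_add hu]
    congr 1
    ring
  rw [e1, e2, e3]
  ring

lemma aux_const (a Λ t : ℝ) (hΛ : 0 < Λ) (ht : 0 < t) :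
    t / Real.sqrt (2 * Real.pi) * (t ^ 2 / 2) ^ (a - 1 / 2) =
    t ^ (a + 1 / 2) * Λ ^ ((1 : ℝ) / 4 - a / 2) * (2 : ℝ) ^ ((3 : ℝ) / 4 - a / 2) /
      Real.sqrt Real.pi * ((1 / 2) * (t * Real.sqrt (2 * Λ) / 2) ^ (a - 1 / 2)) := by
  have hp := Real.pi_pos
  have l2 : 0 < Real.sqrt (2 * Λ) := by positivity
  refine Real.log_injOn_pos (Set.mem_Ioi.2 (by positivity)) (Set.mem_Ioi.2 (by positivity)) ?_
  rw [Real.log_mul (by positivity) (by positivity), Real.log_div (by positivity) (by positivity),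
    Real.log_mul (by positivity) (by positivity), Real.log_div (by positivity) (by positivity),
    Real.log_mul (by positivity) (by positivity), Real.log_mul (by positivity) (by positivity),
    Real.log_mul (by positivity) (by positivity),
    Real.log_rpow (by positivity), Real.log_rpow (by positivity), Real.log_rpow (by positivity),
    Real.log_rpow (by positivity), Real.log_rpow (by positivity),
    Real.log_div (by positivity) (by positivity), Real.log_div (by positivity) (by positivity),
    Real.log_div (by positivity) (by positivity),
    Real.log_mul (by positivity) (by positivity),
    Real.log_sqrt (by positivity), Real.log_sqrt (by positivity), Real.log_sqrt (by positivity),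
    Real.log_mul (by positivity) (by positivity), Real.log_mul (by positivity) (by positivity),
    Real.log_pow, Real.log_one]
  push_cast
  ring

lemma aux_term (k : ℕ) (l : Fin k → ℝ) (x : Fin k → ℕ) (s t : ℝ) (hs : 0 < s) :
    (∏ j, ((l j * s) ^ (x j) / (Nat.factorial (x j) : ℝ) * Real.exp (-(l j * s)))) * fpt s t =
    ((∏ j, (l j) ^ (x j) / (Nat.factorial (x j) : ℝ)) * (t / Real.sqrt (2 * Real.pi))) *
      (s ^ (((∑ j, x j : ℕ) : ℝ) - 3 / 2) * Real.exp (-((∑ j, l j) * s)) *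
      Real.exp (-(t ^ 2) / (2 * s))) := by
  have e1 : (∏ j, ((l j * s) ^ (x j) / (Nat.factorial (x j) : ℝ) * Real.exp (-(l j * s)))) =
      (∏ j, (l j) ^ (x j) / (Nat.factorial (x j) : ℝ)) * s ^ (∑ j, x j) *
        Real.exp (-((∑ j, l j) * s)) := by
    rw [Finset.sum_mul, ← Finset.sum_neg_distrib, Real.exp_sum, ← Finset.prod_pow_eq_pow_sum,
      ← Finset.prod_mul_distrib, ← Finset.prod_mul_distrib]
    refine Finset.prod_congr rfl fun j _ => ?_
    rw [mul_pow]
    ring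
  have e2 : Real.sqrt (2 * Real.pi * s ^ 3) = Real.sqrt (2 * Real.pi) * s ^ ((3 : ℝ) / 2) := by
    rw [Real.sqrt_mul (by positivity), Real.sqrt_eq_rpow (s ^ 3), ← Real.rpow_natCast,
      ← Real.rpow_mul hs.le]
    norm_num
  rw [e1, fpt, e2, Real.rpow_sub hs, Real.rpow_natCast]
  have : 0 < Real.sqrt (2 * Real.pi) := by positivity
  field_simp

theorem gcp_fpt_pmf (k : ℕ) (hk : 1 ≤ k) (l : Fin k → ℝ) (hl : ∀ j, 0 < l j)
    (Λ : ℝ) (hΛ : Λ = ∑ j, l j) (n : ℕ) (t : ℝ) (ht : 0 < t) :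
    phat k l n t =
      ∑ x ∈ Omega k n,
        (∏ j, (l j) ^ (x j) / (Nat.factorial (x j) : ℝ)) *
          (t ^ ((↑(∑ j, x j) : ℝ) + 1 / 2) * Λ ^ ((1 : ℝ) / 4 - (↑(∑ j, x j) : ℝ) / 2) *
            (2 : ℝ) ^ ((3 : ℝ) / 4 - (↑(∑ j, x j) : ℝ) / 2) / Real.sqrt Real.pi) *
          besselK ((↑(∑ j, x j) : ℝ) - 1 / 2) (t * Real.sqrt (2 * Λ)) := by
  have hΛ0 : 0 < Λ := by
    rw [hΛ]
    haveI : Nonempty (Fin k) := ⟨⟨0, hk⟩⟩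
    exact Finset.sum_pos (fun j _ => hl j) Finset.univ_nonempty
  have h1 : phat k l n t = ∫ s in Set.Ioi (0 : ℝ), ∑ x ∈ Omega k n,
      ((∏ j, (l j) ^ (x j) / (Nat.factorial (x j) : ℝ)) * (t / Real.sqrt (2 * Real.pi))) *
      (s ^ (((∑ j, x j : ℕ) : ℝ) - 3 / 2) * Real.exp (-(Λ * s)) *
      Real.exp (-(t ^ 2) / (2 * s))) := by
    rw [phat]
    refine setIntegral_congr_fun measurableSet_Ioi fun s hs => ?_
    simp only [gcp]
    rw [Finset.sum_mul]
    refine Finset.sum_congr rfl fun x _ => ?_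
    rw [aux_term k l x s t hs, hΛ]
  rw [h1, integral_finsetSum _ fun x _ => (aux_integrable _ Λ t hΛ0 ht).const_mul _]
  refine Finset.sum_congr rfl fun x _ => ?_
  rw [integral_const_mul, aux_integral _ Λ t hΛ0 ht, besselK]
  have h2 := aux_const (((∑ j, x j : ℕ) : ℝ)) Λ t hΛ0 ht
  rw [mul_assoc (∏ j, _), ← mul_assoc (t / _), h2]
  ring
end
end

section
/- For every γ > 0, every n ∈ ℕ₀ and t > 0, the state probabilities of the GCP at squared Bessel time satisfy p̄_γ(n,t) = ∑_{Ω(k,n)} (∏_{j=1}^k λ_j^{x_j}/x_j!) · (2t)^{z_k} Γ(z_k + γ/2) / (Γ(γ/2) (2Λt + 1)^{z_k + γ/2}), where z_k = x_1 + x_2 + ⋯ + x_k. -/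
noncomputable section
open MeasureTheory Real Finset

/-- Density of the squared Bessel process of parameter γ started at 0. -/
def sqBessel (γ s t : ℝ) : ℝ :=
  Real.exp (-(s / (2 * t))) * s ^ (γ / 2 - 1) / ((2 * t) ^ (γ / 2) * Real.Gamma (γ / 2))

/-- State probabilities of the GCP at squared Bessel time. -/
def pbar (k : ℕ) (l : Fin k → ℝ) (γ : ℝ) (n : ℕ) (t : ℝ) : ℝ :=
  ∫ s in Set.Ioi (0 : ℝ), gcp k l n s * sqBessel γ s t

theorem gcp_sqBessel_pmf (k : ℕ) (hk : 1 ≤ k) (l : Fin k → ℝ) (hl : ∀ j, 0 < l j)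
    (Λ : ℝ) (hΛ : Λ = ∑ j, l j) (γ : ℝ) (hγ : 0 < γ) (n : ℕ) (t : ℝ) (ht : 0 < t) :
    pbar k l γ n t =
      ∑ x ∈ Omega k n,
        (∏ j, (l j) ^ (x j) / (Nat.factorial (x j) : ℝ)) *
          ((2 * t) ^ (∑ j, x j) * Real.Gamma ((↑(∑ j, x j) : ℝ) + γ / 2) /
            (Real.Gamma (γ / 2) * (2 * Λ * t + 1) ^ ((↑(∑ j, x j) : ℝ) + γ / 2))) := by
  have hΛ0 : 0 ≤ Λ := hΛ ▸ Finset.sum_nonneg fun j _ => (hl j).le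
  have hr : 0 < Λ + 1 / (2 * t) := by positivity
  have hG : Real.Gamma (γ / 2) ≠ 0 := (Real.Gamma_pos_of_pos (by positivity)).ne'
  have hpt : ∀ s ∈ Set.Ioi (0 : ℝ), gcp k l n s * sqBessel γ s t =
      ∑ x ∈ Omega k n, (∏ j, (l j) ^ (x j) / (Nat.factorial (x j) : ℝ)) /
        ((2 * t) ^ (γ / 2) * Real.Gamma (γ / 2)) *
        (s ^ (((↑(∑ j, x j) : ℝ) + γ / 2) - 1) * Real.exp (-((Λ + 1 / (2 * t)) * s))) := by
    intro s hs
    have hs : 0 < s := hs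
    unfold gcp sqBessel
    rw [Finset.sum_mul]
    refine Finset.sum_congr rfl fun x _ => ?_
    have h1 : ∏ j, ((l j * s) ^ (x j) / (Nat.factorial (x j) : ℝ) * Real.exp (-(l j * s))) =
        (∏ j, (l j) ^ (x j) / (Nat.factorial (x j) : ℝ)) * s ^ (∑ j, x j) *
          Real.exp (-(Λ * s)) := by
      rw [hΛ, Finset.sum_mul, ← Finset.sum_neg_distrib, Real.exp_sum,
        ← Finset.prod_pow_eq_pow_sum, ← Finset.prod_mul_distrib, ← Finset.prod_mul_distrib]
      refine Finset.prod_congr rfl fun j _ => ?_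
      rw [mul_pow]
      ring
    have h2 : s ^ (((↑(∑ j, x j) : ℝ) + γ / 2) - 1) = s ^ (∑ j, x j) * s ^ (γ / 2 - 1) := by
      rw [add_sub_assoc, Real.rpow_add hs, Real.rpow_natCast]
    have h3 : Real.exp (-((Λ + 1 / (2 * t)) * s)) =
        Real.exp (-(Λ * s)) * Real.exp (-(s / (2 * t))) := by
      rw [← Real.exp_add]
      congr 1
      ring
    rw [h1, h2, h3]
    ring
  unfold pbar
  rw [setIntegral_congr_fun measurableSet_Ioi hpt, integral_finsetSum]
  · refine Finset.sum_congr rfl fun x _ => ?_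
    have ha : 0 < (↑(∑ j, x j) : ℝ) + γ / 2 := by positivity
    rw [integral_const_mul, Real.integral_rpow_mul_exp_neg_mul_Ioi ha hr]
    have hq : 1 / (Λ + 1 / (2 * t)) = (2 * t) / (2 * Λ * t + 1) := by
      field_simp
    have h2t : (0 : ℝ) < 2 * t := by positivity
    have hD : (0 : ℝ) < 2 * Λ * t + 1 := by positivity
    rw [hq, Real.div_rpow h2t.le hD.le, Real.rpow_add h2t, Real.rpow_natCast]
    have e1 := (Real.rpow_pos_of_pos h2t (γ / 2)).ne'
    have e2 := (Real.rpow_pos_of_pos hD ((↑(∑ j, x j) : ℝ) + γ / 2)).ne'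
    generalize (2 * Λ * t + 1) ^ ((↑(∑ j, x j) : ℝ) + γ / 2) = D at *
    generalize (2 * t) ^ (γ / 2) = E at *
    field_simp
  · intro x _
    have ha : -1 < (↑(∑ j, x j) : ℝ) + γ / 2 - 1 := by
      have : 0 < (↑(∑ j, x j) : ℝ) + γ / 2 := by positivity
      linarith
    refine Integrable.const_mul ?_ _
    have := integrableOn_rpow_mul_exp_neg_mul_rpow ha one_pos hr
    simpa only [Real.rpow_one, neg_mul, IntegrableOn] using this
end
end

section
/- For every γ > 0 and t > 0, the mean of the GCP at squared Bessel time is ∑_{n=0}^∞ n p̄_γ(n,t) = c₁ γ t. -/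
noncomputable section
open MeasureTheory Real Finset

lemma aux_congr {β : Type} {f g : β → ℝ} {a b : ℝ} (h : HasSum f a) (hfg : ∀ x, g x = f x)
    (hab : b = a) : HasSum g b := by
  rw [hab, funext hfg]
  exact h

lemma aux_pois0 (m : ℝ) :
    HasSum (fun n : ℕ => m ^ n / (Nat.factorial n : ℝ) * Real.exp (-m)) 1 := by
  have h := (NormedSpace.expSeries_div_hasSum_exp (𝔸 := ℝ) m).mul_right (Real.exp (-m))
  rw [← Real.exp_eq_exp_ℝ, ← Real.exp_add] at h
  simpa using h

lemma aux_pois1 (m : ℝ) :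
    HasSum (fun n : ℕ => (n : ℝ) * (m ^ n / (Nat.factorial n : ℝ) * Real.exp (-m))) m := by
  rw [← hasSum_nat_add_iff' 1]
  have h := (aux_pois0 m).mul_left m
  simp only [mul_one] at h
  simp only [Finset.sum_range_one, Nat.cast_zero, zero_mul, sub_zero]
  refine aux_congr h (fun n => ?_) rfl
  have : (Nat.factorial n : ℝ) ≠ 0 := by positivity
  rw [Nat.factorial_succ]
  push_cast
  field_simp
  ring

lemma aux_pi (k : ℕ) (f : Fin k → ℕ → ℝ) (a : Fin k → ℝ) (h0 : ∀ j n, 0 ≤ f j n)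
    (h : ∀ j, HasSum (f j) (a j)) :
    HasSum (fun x : Fin k → ℕ => ∏ j, f j (x j)) (∏ j, a j) := by
  induction k with
  | zero => simpa using hasSum_unique (fun x : Fin 0 → ℕ => ∏ j, f j (x j))
  | succ k ih =>
    have h1 := ih (fun j => f j.succ) (fun j => a j.succ) (fun j n => h0 _ n) (fun j => h _)
    have hs := Summable.mul_of_nonneg (h 0).summable h1.summable (fun n => h0 0 n)
      (fun x => Finset.prod_nonneg fun j _ => h0 _ _)
    have h2 := (h 0).mul h1 hs
    rw [Fin.prod_univ_succ, ← (Fin.consEquiv (fun _ : Fin (k+1) => ℕ)).hasSum_iff]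
    refine aux_congr h2 (fun x => ?_) rfl
    simp [Fin.prod_univ_succ, Fin.consEquiv]

lemma aux_mem (k n : ℕ) (x : Fin k → ℕ) :
    x ∈ Omega k n ↔ ∑ j, (j.val + 1) * x j = n := by
  unfold Omega
  simp only [Finset.mem_filter, Fintype.mem_piFinset, Finset.mem_range, and_iff_right_iff_imp]
  rintro rfl j
  have := Finset.single_le_sum (f := fun j : Fin k => (j.val + 1) * x j)
    (fun _ _ => Nat.zero_le _) (Finset.mem_univ j)
  nlinarith [Nat.zero_le (j.val * x j)]

lemma aux_mean (k : ℕ) (l : Fin k → ℝ) (hl : ∀ j, 0 < l j) (s : ℝ) (hs : 0 ≤ s) :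
    HasSum (fun n : ℕ => (n : ℝ) * gcp k l n s) ((∑ j, (j.val + 1 : ℝ) * l j) * s) := by
  classical
  set P : (Fin k → ℕ) → ℝ := fun x => ∏ j, ((l j * s) ^ (x j) / (Nat.factorial (x j) : ℝ) *
    Real.exp (-(l j * s))) with hP
  have hls : ∀ j, 0 ≤ l j * s := fun j => mul_nonneg (hl j).le hs
  have h1 : ∀ i, HasSum (fun x : Fin k → ℕ => (x i : ℝ) * P x) (l i * s) := by
    intro i
    have := aux_pi k (fun j n => (if j = i then (n : ℝ) else 1) *
      ((l j * s) ^ n / (Nat.factorial n : ℝ) * Real.exp (-(l j * s))))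
      (fun j => if j = i then l j * s else 1)
      (fun j n => by
        have := hls j
        have : (0:ℝ) ≤ if j = i then (n : ℝ) else 1 := by split_ifs <;> positivity
        positivity)
      (fun j => by
        by_cases hj : j = i
        · simpa [hj] using aux_pois1 (l i * s)
        · simpa [hj] using aux_pois0 (l j * s))
    simpa only [Finset.prod_mul_distrib (f := fun j => if j = i then _ else _),
      Finset.prod_ite_eq', Finset.mem_univ, if_true, hP] using this
  have h2 : HasSum (fun x : Fin k → ℕ => ((∑ j, (j.val + 1) * x j : ℕ) : ℝ) * P x)
      ((∑ j, (j.val + 1 : ℝ) * l j) * s) := by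
    have := hasSum_sum (s := Finset.univ) fun i _ => (h1 i).mul_left ((i.val : ℝ) + 1)
    refine aux_congr this (fun x => ?_) ?_
    · push_cast
      rw [Finset.sum_mul]
      exact Finset.sum_congr rfl fun _ _ => by ring
    · rw [Finset.sum_mul]
      exact Finset.sum_congr rfl fun _ _ => by ring
  set φ : (Fin k → ℕ) → ℕ := fun x => ∑ j, (j.val + 1) * x j with hφ
  rw [← (Equiv.sigmaFiberEquiv φ).hasSum_iff] at h2
  refine h2.sigma fun n => ?_
  have h3 : HasSum (fun x : {x // x ∈ Omega k n} => (n : ℝ) * P x) ((n : ℝ) * gcp k l n s) := by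
    have := hasSum_fintype (fun x : {x // x ∈ Omega k n} => (n : ℝ) * P x)
    convert this using 1
    rw [gcp, Finset.mul_sum, ← Finset.sum_coe_sort]
  rw [← (Equiv.subtypeEquivRight (fun x => aux_mem k n x)).symm.hasSum_iff] at h3
  refine aux_congr h3 (fun x => ?_) rfl
  obtain ⟨x, hx⟩ := x
  change ((φ x : ℕ) : ℝ) * P x = (n : ℝ) * P x
  rw [hx]

lemma aux_gcp_nonneg (k : ℕ) (l : Fin k → ℝ) (hl : ∀ j, 0 < l j) (n : ℕ) (s : ℝ) (hs : 0 ≤ s) :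
    0 ≤ gcp k l n s := by
  refine Finset.sum_nonneg fun x _ => Finset.prod_nonneg fun j _ => ?_
  have := mul_nonneg (hl j).le hs
  positivity

lemma aux_sqB (γ t : ℝ) (hγ : 0 < γ) (ht : 0 < t) :
    ∫ s in Set.Ioi (0 : ℝ), s * sqBessel γ s t = γ * t := by
  have h := Real.integral_rpow_mul_exp_neg_mul_Ioi (a := γ / 2 + 1) (r := 1 / (2 * t))
    (by positivity) (by positivity)
  have e : ∀ s ∈ Set.Ioi (0 : ℝ), s * sqBessel γ s t =
      ((2 * t) ^ (γ / 2) * Real.Gamma (γ / 2))⁻¹ *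
        (s ^ (γ / 2 + 1 - 1) * Real.exp (-(1 / (2 * t) * s))) := by
    intro s hs
    have hs : 0 < s := hs
    have : s ^ (γ / 2 + 1 - 1) = s ^ (γ / 2 - 1) * s := by
      rw [← Real.rpow_add_one hs.ne']; ring_nf
    rw [this, sqBessel, show 1 / (2 * t) * s = s / (2 * t) by ring, div_eq_mul_inv]
    ring
  rw [setIntegral_congr_fun measurableSet_Ioi e, integral_const_mul, h,
    Real.Gamma_add_one (by positivity), one_div_one_div, Real.rpow_add_one (by positivity)]
  have h1 : (2 * t) ^ (γ / 2) ≠ 0 := by positivity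
  have h2 : Real.Gamma (γ / 2) ≠ 0 := (Real.Gamma_pos_of_pos (by positivity)).ne'
  field_simp

theorem gcp_sqBessel_mean (k : ℕ) (hk : 1 ≤ k) (l : Fin k → ℝ) (hl : ∀ j, 0 < l j)
    (c₁ : ℝ) (hc₁ : c₁ = ∑ j, (j.val + 1 : ℝ) * l j)
    (γ t : ℝ) (hγ : 0 < γ) (ht : 0 < t) :
    (∑' n : ℕ, (n : ℝ) * pbar k l γ n t) = c₁ * γ * t := by
  subst hc₁
  set c := ∑ j, (j.val + 1 : ℝ) * l j with hc
  have hB : ∀ s ∈ Set.Ioi (0 : ℝ), 0 ≤ sqBessel γ s t := by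
    intro s hs
    have hs : 0 < s := hs
    have h2 := Real.Gamma_pos_of_pos (show 0 < γ / 2 by positivity)
    unfold sqBessel
    positivity
  have hsum : ∀ s ∈ Set.Ioi (0 : ℝ),
      HasSum (fun n : ℕ => (n : ℝ) * (gcp k l n s * sqBessel γ s t))
        (c * (s * sqBessel γ s t)) := by
    intro s hs
    have := (aux_mean k l hl s (le_of_lt hs)).mul_right (sqBessel γ s t)
    simpa only [mul_assoc] using this
  have hI := aux_sqB γ t hγ ht
  have hint : IntegrableOn (fun s => s * sqBessel γ s t) (Set.Ioi 0) := by
    by_contra hn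
    rw [integral_undef hn] at hI
    have : 0 < γ * t := by positivity
    linarith
  have key := hasSum_integral_of_dominated_convergence (μ := volume.restrict (Set.Ioi (0:ℝ)))
    (F := fun (n : ℕ) s => (n : ℝ) * (gcp k l n s * sqBessel γ s t))
    (f := fun s => c * (s * sqBessel γ s t))
    (fun (n : ℕ) s => (n : ℝ) * (gcp k l n s * sqBessel γ s t))
    (fun n => by
      apply Measurable.aestronglyMeasurable
      unfold gcp sqBessel
      fun_prop)
    (fun n => by
      filter_upwards [ae_restrict_mem measurableSet_Ioi] with s hs
      rw [Real.norm_of_nonneg]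
      exact mul_nonneg (Nat.cast_nonneg _)
        (mul_nonneg (aux_gcp_nonneg k l hl n s (le_of_lt hs)) (hB s hs)))
    (by
      filter_upwards [ae_restrict_mem measurableSet_Ioi] with s hs
      exact (hsum s hs).summable)
    (by
      refine (hint.const_mul c).congr ?_
      filter_upwards [ae_restrict_mem measurableSet_Ioi] with s hs
      exact (hsum s hs).tsum_eq.symm)
    (by
      filter_upwards [ae_restrict_mem measurableSet_Ioi] with s hs
      exact hsum s hs)
  simp only [integral_const_mul] at key
  rw [hI] at key
  rw [mul_assoc]
  exact key.tsum_eq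
end
end

section
/- For the elastic Brownian motion with absorbing rate γ = Λ, every n ≥ 1 and t > 0, p^{el}_Λ(n,t) = ∑_{Ω(k,n)} (∏_{j=1}^k λ_j^{x_j}/x_j!) z_k! (t/2)^{z_k/2} E^{z_k+2}_{1/2, z_k/2 + 1}(−Λ√t/√2), where z_k = x_1 + x_2 + ⋯ + x_k. -/
noncomputable section
open MeasureTheory Real Finset

/-- Sub-probability density on (0,∞) of the elastic Brownian motion with absorbing rate γ. -/
def elasticDens (γ s t : ℝ) : ℝ :=
  2 * Real.exp (γ * s) *
    ∫ v in Set.Ioi s, v * Real.exp (-(γ * v)) * Real.exp (-(v ^ 2 / (2 * t))) /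
      Real.sqrt (2 * Real.pi * t ^ 3)

/-- The three-parameter Mittag-Leffler function E^c_{a,b}(x). -/
def mittagLeffler3 (a b c x : ℝ) : ℝ :=
  (1 / Real.Gamma c) *
    ∑' j : ℕ, Real.Gamma ((j : ℝ) + c) * x ^ j / ((Nat.factorial j : ℝ) * Real.Gamma ((j : ℝ) * a + b))

lemma gcp_aux_intg (m : ℕ) (a t : ℝ) (ht : 0 < t) :
    IntegrableOn (fun v : ℝ => v ^ m * (Real.exp (-(a * v)) * Real.exp (-(v ^ 2 / (2 * t)))))
      (Set.Ioi 0) := by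
  have h := (integrableOn_rpow_mul_exp_neg_mul_sq (b := 1 / (4 * t)) (by positivity)
    (s := (m : ℝ)) (by have := Nat.cast_nonneg (α := ℝ) m; linarith)).const_mul (Real.exp (a ^ 2 * t))
  refine Integrable.mono' h (by fun_prop) ?_
  refine (ae_restrict_iff' measurableSet_Ioi).2 (Filter.Eventually.of_forall fun v hv => ?_)
  have hv : 0 < v := hv
  rw [Real.norm_eq_abs, abs_of_nonneg (by positivity), Real.rpow_natCast,
    mul_left_comm (Real.exp (a ^ 2 * t)), ← Real.exp_add, ← Real.exp_add]
  refine mul_le_mul_of_nonneg_left (Real.exp_le_exp.2 ?_) (by positivity)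
  have h2 : a ^ 2 * t + -(1 / (4 * t)) * v ^ 2 - (-(a * v) + -(v ^ 2 / (2 * t)))
      = (v / 2 + a * t) ^ 2 / t := by
    field_simp
    ring
  have h3 : 0 ≤ (v / 2 + a * t) ^ 2 / t := by positivity
  linarith

lemma gcp_aux_fub (f : ℝ → ℝ) (hc : Continuous f)
    (hf : IntegrableOn (fun v => Real.exp v * f v) (Set.Ioi 0)) (z : ℕ) :
    IntegrableOn (fun s : ℝ => s ^ z * ∫ v in Set.Ioi s, f v) (Set.Ioi 0) ∧
    ∫ s in Set.Ioi (0 : ℝ), s ^ z * ∫ v in Set.Ioi s, f v =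
      ∫ v in Set.Ioi (0 : ℝ), v ^ (z + 1) / ((z : ℝ) + 1) * f v := by
  set F : ℝ → ℝ → ℝ := fun s v => Set.indicator {p : ℝ × ℝ | p.1 < p.2}
    (fun p => p.1 ^ z * f p.2) (s, v) with hF
  have hm : MeasurableSet {p : ℝ × ℝ | p.1 < p.2} := measurableSet_lt measurable_fst measurable_snd
  have hg : IntegrableOn (fun x : ℝ => Real.exp (-x) * x ^ z) (Set.Ioi 0) := by
    have := Real.GammaIntegral_convergent (s := (z : ℝ) + 1) (by positivity)
    simpa using this
  have hint : Integrable (Function.uncurry F)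
      ((volume.restrict (Set.Ioi (0 : ℝ))).prod (volume.restrict (Set.Ioi (0 : ℝ)))) := by
    refine Integrable.mono (Integrable.mul_prod hg hf) ?_ ?_
    · have hu : Function.uncurry F = Set.indicator {p : ℝ × ℝ | p.1 < p.2}
        (fun p => p.1 ^ z * f p.2) := by
        ext ⟨s, v⟩; rfl
      rw [hu]
      exact (Continuous.aestronglyMeasurable (by fun_prop)).indicator hm
    · refine Filter.Eventually.of_forall fun ⟨s, v⟩ => ?_
      by_cases h : s < v
      · have : Function.uncurry F (s, v) = s ^ z * f v := by simp [hF, h]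
        rw [this]
        have h1 : (1 : ℝ) ≤ Real.exp (-s) * Real.exp v := by
          rw [← Real.exp_add]; exact Real.one_le_exp (by linarith)
        have h2 : Real.exp (-s) * s ^ z * (Real.exp v * f v)
          = (Real.exp (-s) * Real.exp v) * (s ^ z * f v) := by ring
        simp only []
        rw [h2, norm_mul (Real.exp (-s) * Real.exp v), Real.norm_of_nonneg (by positivity : (0:ℝ) ≤ Real.exp (-s) * Real.exp v)]
        exact le_mul_of_one_le_left (norm_nonneg _) h1
      · have : Function.uncurry F (s, v) = 0 := by simp [hF, h]
        rw [this, norm_zero]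
        exact norm_nonneg _
  have hin : ∀ s ∈ Set.Ioi (0 : ℝ), ∫ v in Set.Ioi (0 : ℝ), F s v = s ^ z * ∫ v in Set.Ioi s, f v := by
    intro s hs
    have : (fun v => F s v) = (Set.Ioi s).indicator (fun v => s ^ z * f v) := by
      ext v
      simp [hF, Set.indicator]
    rw [this, setIntegral_indicator measurableSet_Ioi, Set.inter_eq_right.2
      (Set.Ioi_subset_Ioi (le_of_lt hs)), integral_const_mul]
  have hin2 : ∀ v ∈ Set.Ioi (0 : ℝ), ∫ s in Set.Ioi (0 : ℝ), F s v =
      v ^ (z + 1) / ((z : ℝ) + 1) * f v := by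
    intro v hv
    have : (fun s => F s v) = (Set.Iio v).indicator (fun s => s ^ z * f v) := by
      ext s
      simp [hF, Set.indicator]
    rw [this, setIntegral_indicator measurableSet_Iio, Set.Ioi_inter_Iio, integral_mul_const,
      ← integral_Ioc_eq_integral_Ioo, ← intervalIntegral.integral_of_le (le_of_lt hv), integral_pow]
    simp
  constructor
  · have := hint.integral_prod_left
    exact IntegrableOn.congr_fun this hin measurableSet_Ioi
  · rw [← setIntegral_congr_fun measurableSet_Ioi hin, ← setIntegral_congr_fun measurableSet_Ioi hin2]
    exact integral_integral_swap hint

lemma gcp_aux_mom (m : ℕ) (t : ℝ) (ht : 0 < t) :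
    ∫ v in Set.Ioi (0 : ℝ), v ^ m * Real.exp (-(v ^ 2 / (2 * t))) =
      (2 * t) ^ (((m : ℝ) + 1) / 2) * (1 / 2) * Real.Gamma (((m : ℝ) + 1) / 2) := by
  have h := integral_rpow_mul_exp_neg_mul_rpow (p := 2) (q := (m : ℝ)) (b := (2 * t)⁻¹) two_pos
    (by have := Nat.cast_nonneg (α := ℝ) m; linarith) (by positivity)
  rw [Real.inv_rpow (by positivity), ← Real.rpow_neg (by positivity), neg_div, neg_neg] at h
  rw [← h]
  refine setIntegral_congr_fun measurableSet_Ioi fun v _ => ?_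
  simp only [Real.rpow_natCast, Real.rpow_two]
  congr 2
  ring

lemma gcp_aux_series (m : ℕ) (a t : ℝ) (ha : 0 ≤ a) (ht : 0 < t) :
    HasSum (fun j : ℕ => (-a) ^ j / (Nat.factorial j : ℝ) *
      ((2 * t) ^ (((↑(m + j) : ℝ) + 1) / 2) * (1 / 2) * Real.Gamma (((↑(m + j) : ℝ) + 1) / 2)))
    (∫ v in Set.Ioi (0 : ℝ), v ^ m * (Real.exp (-(a * v)) * Real.exp (-(v ^ 2 / (2 * t))))) := by
  have hexp : ∀ x y : ℝ, HasSum (fun j : ℕ => x ^ j / (Nat.factorial j : ℝ) * y) (Real.exp x * y) := by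
    intro x y
    rw [Real.exp_eq_exp_ℝ]
    exact (NormedSpace.expSeries_div_hasSum_exp x).mul_right y
  have key := hasSum_integral_of_dominated_convergence (μ := volume.restrict (Set.Ioi (0 : ℝ)))
    (F := fun (j : ℕ) v => (-(a * v)) ^ j / (Nat.factorial j : ℝ) * (v ^ m * Real.exp (-(v ^ 2 / (2 * t)))))
    (f := fun v => Real.exp (-(a * v)) * (v ^ m * Real.exp (-(v ^ 2 / (2 * t)))))
    (fun (j : ℕ) v => (a * v) ^ j / (Nat.factorial j : ℝ) * (v ^ m * Real.exp (-(v ^ 2 / (2 * t)))))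
    (fun j => by fun_prop) ?_ ?_ ?_ ?_
  · have e1 : ∀ j : ℕ, (-a) ^ j / (Nat.factorial j : ℝ) *
        ((2 * t) ^ (((↑(m + j) : ℝ) + 1) / 2) * (1 / 2) * Real.Gamma (((↑(m + j) : ℝ) + 1) / 2)) =
        ∫ v in Set.Ioi (0 : ℝ), (-(a * v)) ^ j / (Nat.factorial j : ℝ) *
          (v ^ m * Real.exp (-(v ^ 2 / (2 * t)))) := by
      intro j
      rw [← gcp_aux_mom _ _ ht, ← integral_const_mul]
      congr 1
      ext v
      rw [← neg_mul, mul_pow, pow_add]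
      ring
    have e2 : ∀ v : ℝ, v ^ m * (Real.exp (-(a * v)) * Real.exp (-(v ^ 2 / (2 * t)))) =
        Real.exp (-(a * v)) * (v ^ m * Real.exp (-(v ^ 2 / (2 * t)))) := fun v => by ring
    simp only [e1, e2]
    exact key
  · intro j
    refine (ae_restrict_iff' measurableSet_Ioi).2 (Filter.Eventually.of_forall fun v hv => ?_)
    have hv : 0 < v := hv
    rw [norm_mul, norm_div, norm_pow, norm_neg, Real.norm_of_nonneg (by positivity : 0 ≤ a * v),
      Real.norm_of_nonneg (by positivity : (0 : ℝ) ≤ (Nat.factorial j : ℝ)),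
      Real.norm_of_nonneg (by positivity : (0 : ℝ) ≤ v ^ m * Real.exp (-(v ^ 2 / (2 * t))))]
  · exact Filter.Eventually.of_forall fun v => (hexp _ _).summable
  · have : (fun v : ℝ => ∑' j : ℕ, (a * v) ^ j / (Nat.factorial j : ℝ) *
        (v ^ m * Real.exp (-(v ^ 2 / (2 * t))))) =
        fun v : ℝ => v ^ m * (Real.exp (-(-a * v)) * Real.exp (-(v ^ 2 / (2 * t)))) := by
      ext v
      rw [(hexp _ _).tsum_eq]
      simp only [neg_mul, neg_neg]
      ring
    rw [this]
    exact gcp_aux_intg m (-a) t ht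
  · exact Filter.Eventually.of_forall fun v => hexp _ _

lemma gcp_aux_term (z j : ℕ) (a t : ℝ) (ht : 0 < t) :
    2 / ((z : ℝ) + 1) / Real.sqrt (2 * Real.pi * t ^ 3) * ((-a) ^ j / (Nat.factorial j : ℝ) *
      ((2 * t) ^ (((↑(z + 2 + j) : ℝ) + 1) / 2) * (1 / 2) *
        Real.Gamma (((↑(z + 2 + j) : ℝ) + 1) / 2))) =
    (Nat.factorial z : ℝ) * (t / 2) ^ ((z : ℝ) / 2) * (1 / Real.Gamma ((z : ℝ) + 2) *
      (Real.Gamma ((j : ℝ) + ((z : ℝ) + 2)) * (-(a * Real.sqrt t / Real.sqrt 2)) ^ j /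
        ((Nat.factorial j : ℝ) * Real.Gamma ((j : ℝ) * (1 / 2) + ((z : ℝ) / 2 + 1))))) := by
  have hG : Real.Gamma ((z : ℝ) + 2) = ((z : ℝ) + 1) * (Nat.factorial z : ℝ) := by
    have := Real.Gamma_nat_eq_factorial (z + 1)
    push_cast [Nat.factorial_succ] at this
    rw [← this]; ring_nf
  have hdup := Real.Gamma_mul_Gamma_add_half ((j : ℝ) * (1 / 2) + ((z : ℝ) / 2 + 1))
  have e1 : (j : ℝ) * (1 / 2) + ((z : ℝ) / 2 + 1) + 1 / 2 = ((↑(z + 2 + j) : ℝ) + 1) / 2 := by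
    push_cast; ring
  have e2 : 2 * ((j : ℝ) * (1 / 2) + ((z : ℝ) / 2 + 1)) = (j : ℝ) + ((z : ℝ) + 2) := by ring
  rw [e1, e2] at hdup
  have hw : 0 < Real.Gamma ((j : ℝ) * (1 / 2) + ((z : ℝ) / 2 + 1)) :=
    Real.Gamma_pos_of_pos (by positivity)
  set w := Real.Gamma ((j : ℝ) * (1 / 2) + ((z : ℝ) / 2 + 1))
  set A := Real.Gamma (((↑(z + 2 + j) : ℝ) + 1) / 2)
  set B := Real.Gamma ((j : ℝ) + ((z : ℝ) + 2))
  -- powers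
  set r := Real.sqrt t with hr
  set q := Real.sqrt 2 with hq
  have hr0 : 0 < r := Real.sqrt_pos.2 ht
  have hq0 : 0 < q := Real.sqrt_pos.2 two_pos
  have hrt : r ^ 2 = t := Real.sq_sqrt ht.le
  have hqt : q ^ 2 = 2 := Real.sq_sqrt two_pos.le
  have p1 : (2 * t) ^ (((↑(z + 2 + j) : ℝ) + 1) / 2) = (q * r) ^ (z + j + 3) := by
    have e : 2 * t = (q * r) ^ 2 := by rw [mul_pow, hrt, hqt]
    rw [e, ← Real.rpow_natCast (q * r) 2, ← Real.rpow_mul (by positivity),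
      ← Real.rpow_natCast]
    congr 1
    push_cast; ring
  have p2 : (t / 2) ^ ((z : ℝ) / 2) = (r / q) ^ z := by
    have e : t / 2 = (r / q) ^ 2 := by rw [div_pow, hrt, hqt]
    rw [e, ← Real.rpow_natCast (r / q) 2, ← Real.rpow_mul (by positivity),
      ← Real.rpow_natCast]
    congr 1
    push_cast; ring
  have p3 : (2 : ℝ) ^ (1 - ((j : ℝ) + ((z : ℝ) + 2))) = (q ^ (2 * (j + z + 1)))⁻¹ := by
    rw [pow_mul, hqt, ← Real.rpow_natCast, ← Real.rpow_neg two_pos.le]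
    congr 1
    push_cast; ring
  have p4 : Real.sqrt (2 * Real.pi * t ^ 3) = q * Real.sqrt Real.pi * r ^ 3 := by
    rw [Real.sqrt_mul (by positivity), Real.sqrt_mul two_pos.le]
    congr 1
    rw [← hrt, ← pow_mul, mul_comm 2 3, pow_mul, Real.sqrt_sq (by positivity)]
  rw [p3] at hdup
  rw [p1, p2, p4, hG]
  have hpi : 0 < Real.sqrt Real.pi := Real.sqrt_pos.2 Real.pi_pos
  have hA : A = B * (q ^ (2 * (j + z + 1)))⁻¹ * Real.sqrt Real.pi / w := by
    rw [← hdup]; field_simp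
  have hz : (0 : ℝ) < Nat.factorial z := by positivity
  rw [hA, neg_pow, neg_pow (a * r / q), div_pow, div_pow]
  field_simp
  ring_nf

lemma gcp_aux_main (z : ℕ) (a t : ℝ) (ha : 0 ≤ a) (ht : 0 < t) :
    IntegrableOn (fun s : ℝ => s ^ z * Real.exp (-(a * s)) * elasticDens a s t) (Set.Ioi 0) ∧
    ∫ s in Set.Ioi (0 : ℝ), s ^ z * Real.exp (-(a * s)) * elasticDens a s t =
      (Nat.factorial z : ℝ) * (t / 2) ^ ((z : ℝ) / 2) *
        mittagLeffler3 (1 / 2) ((z : ℝ) / 2 + 1) ((z : ℝ) + 2) (-(a * Real.sqrt t / Real.sqrt 2)) := by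
  set c := Real.sqrt (2 * Real.pi * t ^ 3) with hc
  have hfun : (fun s : ℝ => s ^ z * Real.exp (-(a * s)) * elasticDens a s t) =
      fun s : ℝ => 2 * (s ^ z * ∫ v in Set.Ioi s,
        v * Real.exp (-(a * v)) * Real.exp (-(v ^ 2 / (2 * t))) / c) := by
    ext s
    unfold elasticDens
    have : Real.exp (-(a * s)) * Real.exp (a * s) = 1 := by rw [← Real.exp_add]; simp
    linear_combination (2 * s ^ z * ∫ v in Set.Ioi s,
        v * Real.exp (-(a * v)) * Real.exp (-(v ^ 2 / (2 * t))) / c) * this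
  have hf := gcp_aux_fub (fun v => v * Real.exp (-(a * v)) * Real.exp (-(v ^ 2 / (2 * t))) / c)
    (by fun_prop) (by
      have := (gcp_aux_intg 1 (a - 1) t ht).div_const c
      refine this.congr (Filter.Eventually.of_forall fun v => ?_)
      have h1 : Real.exp (-((a - 1) * v)) = Real.exp v * Real.exp (-(a * v)) := by
        rw [← Real.exp_add]; ring_nf
      simp only [h1]
      ring) z
  rw [hfun]
  refine ⟨hf.1.const_mul 2, ?_⟩
  rw [integral_const_mul, hf.2]
  have hs := (gcp_aux_series (z + 2) a t ha ht).mul_left (2 / ((z : ℝ) + 1) / c)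
  simp only [hc, gcp_aux_term z _ a t ht] at hs
  rw [mittagLeffler3, ← tsum_mul_left, ← tsum_mul_left, hs.tsum_eq, ← integral_const_mul,
    ← integral_const_mul]
  congr 1
  ext v
  ring

theorem gcp_elastic_pn (k : ℕ) (hk : 1 ≤ k) (l : Fin k → ℝ) (hl : ∀ j, 0 < l j)
    (Λ : ℝ) (hΛ : Λ = ∑ j, l j) (n : ℕ) (hn : 1 ≤ n) (t : ℝ) (ht : 0 < t) :
    (∫ s in Set.Ioi (0 : ℝ), gcp k l n s * elasticDens Λ s t) =
      ∑ x ∈ Omega k n,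
        (∏ j, (l j) ^ (x j) / (Nat.factorial (x j) : ℝ)) *
          (Nat.factorial (∑ j, x j) : ℝ) * (t / 2) ^ ((↑(∑ j, x j) : ℝ) / 2) *
          mittagLeffler3 (1 / 2) ((↑(∑ j, x j) : ℝ) / 2 + 1) ((↑(∑ j, x j) : ℝ) + 2)
            (-(Λ * Real.sqrt t / Real.sqrt 2)) := by
  have hpos : 0 ≤ Λ := by rw [hΛ]; exact Finset.sum_nonneg fun j _ => (hl j).le
  have hfun : (fun s : ℝ => gcp k l n s * elasticDens Λ s t) = fun s : ℝ =>
      ∑ x ∈ Omega k n, (∏ j, (l j) ^ (x j) / (Nat.factorial (x j) : ℝ)) *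
        (s ^ (∑ j, x j) * Real.exp (-(Λ * s)) * elasticDens Λ s t) := by
    ext s
    rw [gcp, Finset.sum_mul]
    refine Finset.sum_congr rfl fun x _ => ?_
    have h1 : ∏ j, ((l j * s) ^ (x j) / (Nat.factorial (x j) : ℝ) * Real.exp (-(l j * s))) =
        (∏ j, (l j) ^ (x j) / (Nat.factorial (x j) : ℝ)) *
          (s ^ (∑ j, x j) * Real.exp (-(Λ * s))) := by
      rw [hΛ, Finset.sum_mul, ← Finset.sum_neg_distrib, Real.exp_sum,
        ← Finset.prod_pow_eq_pow_sum, ← Finset.prod_mul_distrib, ← Finset.prod_mul_distrib]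
      refine Finset.prod_congr rfl fun j _ => ?_
      rw [mul_pow]
      ring
    rw [h1]
    ring
  rw [hfun, integral_finsetSum _ fun x _ => (gcp_aux_main _ Λ t hpos ht).1.const_mul _]
  refine Finset.sum_congr rfl fun x _ => ?_
  rw [integral_const_mul, (gcp_aux_main _ Λ t hpos ht).2]
  ring
end
end

section
/- For every n ∈ ℕ₀ and t > 0, the state probabilities of the GCP at Brownian sojourn time satisfy p⁺(n,t) = ∑_{Ω(k,n)} (∏_{j=1}^k λ_j^{x_j}/x_j!) (t^{z_k}/π) e^{−Λt} B(1/2, z_k + 1/2) · ₁F₁(1/2; z_k + 1; Λt), where z_k = x_1 + x_2 + ⋯ + x_k. -/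
noncomputable section
open MeasureTheory Real Finset

/-- State probabilities of the GCP at Brownian sojourn time:
p⁺(n,t) = ∫_0^t p(n,x)/(π √(x(t−x))) dx. -/
def pplus (k : ℕ) (l : Fin k → ℝ) (n : ℕ) (t : ℝ) : ℝ :=
  ∫ x in (0 : ℝ)..t, gcp k l n x * (1 / (Real.pi * Real.sqrt (x * (t - x))))

/-- The beta function B(a,b) = Γ(a)Γ(b)/Γ(a+b). -/
def betaFn (a b : ℝ) : ℝ := Real.Gamma a * Real.Gamma b / Real.Gamma (a + b)

/-- The confluent hypergeometric function ₁F₁(a;c;x) = ∑ ((a)_n/(c)_n) xⁿ/n!. -/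
def hyp1F1 (a c x : ℝ) : ℝ :=
  ∑' n : ℕ, ((ascPochhammer ℝ n).eval a / (ascPochhammer ℝ n).eval c) * x ^ n /
    (Nat.factorial n : ℝ)

lemma aux_beta (t : ℝ) (ht : 0 < t) (a b : ℕ) :
    ∫ x in (0 : ℝ)..t, x ^ a * (t - x) ^ b * (1 / (Real.pi * Real.sqrt (x * (t - x)))) =
      t ^ (a + b) / Real.pi * (Real.Gamma (a + 1 / 2) * Real.Gamma (b + 1 / 2) /
        Real.Gamma ((a + 1 / 2) + (b + 1 / 2))) := by
  have h := Complex.betaIntegral_scaled ((a : ℂ) + 1 / 2) ((b : ℂ) + 1 / 2) ht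
  have ha : 0 < ((a : ℂ) + 1 / 2).re := by
    simp; positivity
  have hb : 0 < ((b : ℂ) + 1 / 2).re := by
    simp; positivity
  rw [Complex.betaIntegral_eq_Gamma_mul_div _ _ ha hb] at h
  have h2 : ∫ x in (0 : ℝ)..t, (x : ℂ) ^ ((a : ℂ) + 1 / 2 - 1) *
      ((t : ℂ) - x) ^ ((b : ℂ) + 1 / 2 - 1) =
      ∫ x in (0 : ℝ)..t, (((x ^ a * (t - x) ^ b * (1 / Real.sqrt (x * (t - x))) : ℝ)) : ℂ) := by
    rw [intervalIntegral.integral_of_le ht.le, intervalIntegral.integral_of_le ht.le,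
      integral_Ioc_eq_integral_Ioo, integral_Ioc_eq_integral_Ioo]
    apply setIntegral_congr_fun measurableSet_Ioo
    intro x hx
    have hx0 : 0 < x := hx.1
    have hx1 : 0 < t - x := sub_pos.2 hx.2
    have key : ∀ (y : ℝ) (m : ℕ), 0 < y →
        (y : ℂ) ^ ((m : ℂ) + 1 / 2 - 1) = ((y ^ m * (1 / Real.sqrt y) : ℝ) : ℂ) := by
      intro y m hy
      have : y ^ m * (1 / Real.sqrt y) = y ^ ((m : ℝ) + 1 / 2 - 1) := by
        rw [show (m : ℝ) + 1 / 2 - 1 = m - 1 / 2 by ring, Real.rpow_sub hy, Real.rpow_natCast,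
          Real.sqrt_eq_rpow]
        ring
      rw [this, Complex.ofReal_cpow hy.le]
      push_cast
      rfl
    have e : (t : ℂ) - x = ((t - x : ℝ) : ℂ) := by push_cast; rfl
    simp only
    rw [e, key x a hx0, key _ b hx1, ← Complex.ofReal_mul, Real.sqrt_mul hx0.le]
    congr 1
    field_simp
  rw [h2, intervalIntegral.integral_ofReal] at h
  have h3 : (t : ℂ) ^ ((a : ℂ) + 1 / 2 + ((b : ℂ) + 1 / 2) - 1) = ((t ^ (a + b) : ℝ) : ℂ) := by
    rw [show (a : ℂ) + 1 / 2 + ((b : ℂ) + 1 / 2) - 1 = ((a + b : ℕ) : ℂ) by push_cast; ring,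
      Complex.cpow_natCast]
    push_cast; rfl
  have e1 : (a : ℂ) + 1 / 2 = ((a + 1 / 2 : ℝ) : ℂ) := by push_cast; rfl
  have e2 : (b : ℂ) + 1 / 2 = ((b + 1 / 2 : ℝ) : ℂ) := by push_cast; rfl
  rw [h3, e1, e2, ← Complex.ofReal_add, Complex.Gamma_ofReal, Complex.Gamma_ofReal,
    Complex.Gamma_ofReal] at h
  have h4 := h
  norm_cast at h4
  have h5 : ∀ x : ℝ, x ^ a * (t - x) ^ b * (1 / (Real.pi * Real.sqrt (x * (t - x)))) =
      Real.pi⁻¹ * (x ^ a * (t - x) ^ b * (1 / Real.sqrt (x * (t - x)))) := by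
    intro x
    rw [one_div, mul_inv]; ring
  simp_rw [h5]
  rw [intervalIntegral.integral_const_mul, h4]
  ring

lemma aux_gamma (c : ℝ) (hc : 0 < c) (m : ℕ) :
    Real.Gamma (c + m) = (ascPochhammer ℝ m).eval c * Real.Gamma c := by
  induction m with
  | zero => simp
  | succ m ih =>
    rw [ascPochhammer_succ_eval, Nat.cast_succ, ← add_assoc,
      Real.Gamma_add_one (by positivity), ih]
    ring

lemma aux_int (t : ℝ) (ht : 0 < t) (a b : ℕ) :
    IntervalIntegrable (fun x : ℝ => x ^ a * (t - x) ^ b *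
      (1 / (Real.pi * Real.sqrt (x * (t - x))))) volume 0 t := by
  by_contra hcon
  have h := aux_beta t ht a b
  rw [intervalIntegral.integral_undef hcon] at h
  have g1 : 0 < Real.Gamma ((a : ℝ) + 1 / 2) := Real.Gamma_pos_of_pos (by positivity)
  have g2 : 0 < Real.Gamma ((b : ℝ) + 1 / 2) := Real.Gamma_pos_of_pos (by positivity)
  have g3 : 0 < Real.Gamma ((a + 1 / 2 : ℝ) + (b + 1 / 2)) :=
    Real.Gamma_pos_of_pos (by positivity)
  have : 0 < t ^ (a + b) / Real.pi * (Real.Gamma (a + 1 / 2) * Real.Gamma (b + 1 / 2) /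
        Real.Gamma ((a + 1 / 2 : ℝ) + (b + 1 / 2))) := by positivity
  linarith

lemma aux_main (t : ℝ) (ht : 0 < t) (L : ℝ) (z : ℕ) :
    ∫ x in (0 : ℝ)..t, x ^ z * Real.exp (-(L * x)) *
        (1 / (Real.pi * Real.sqrt (x * (t - x)))) =
      (t ^ z / Real.pi) * Real.exp (-(L * t)) * betaFn (1 / 2) ((z : ℝ) + 1 / 2) *
        hyp1F1 (1 / 2) ((z : ℝ) + 1) (L * t) := by
  set w : ℝ → ℝ := fun x => x ^ z * (1 / (Real.pi * Real.sqrt (x * (t - x)))) with hw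
  have hwi : IntervalIntegrable w volume 0 t := by
    have := aux_int t ht z 0
    simpa [hw] using this
  have hexp : ∀ y : ℝ, HasSum (fun m : ℕ => y ^ m / (m.factorial : ℝ)) (Real.exp y) := by
    intro y
    rw [Real.exp_eq_exp_ℝ]
    exact NormedSpace.expSeries_div_hasSum_exp y
  have hs := intervalIntegral.hasSum_integral_of_dominated_convergence (μ := volume)
    (a := 0) (b := t)
    (F := fun (m : ℕ) (x : ℝ) => w x * ((L * (t - x)) ^ m / (m.factorial : ℝ)))
    (f := fun x => w x * Real.exp (L * (t - x)))
    (fun m x => |w x| * ((|L| * t) ^ m / (m.factorial : ℝ)))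
    (by
      intro m
      have h := hwi.mul_continuousOn
        (g := fun x => (L * (t - x)) ^ m / (m.factorial : ℝ)) (by fun_prop)
      exact (intervalIntegrable_iff.1 h).aestronglyMeasurable)
    (by
      intro m
      refine Filter.Eventually.of_forall fun x hx => ?_
      rw [Set.uIoc_of_le ht.le] at hx
      rw [norm_mul (w x), norm_div, norm_pow, norm_mul L, Real.norm_eq_abs, Real.norm_eq_abs,
        Real.norm_eq_abs, Real.norm_eq_abs, Nat.abs_cast, abs_of_nonneg (sub_nonneg.2 hx.2)]
      have : t - x ≤ t := by linarith [hx.1]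
      have h0 : 0 ≤ t - x := sub_nonneg.2 hx.2
      gcongr)
    (Filter.Eventually.of_forall fun x hx => ((hexp _).mul_left _).summable)
    (by
      have : (fun x => ∑' m : ℕ, |w x| * ((|L| * t) ^ m / (m.factorial : ℝ))) =
          fun x => |w x| * Real.exp (|L| * t) := by
        funext x
        exact ((hexp _).mul_left _).tsum_eq
      rw [this]
      exact hwi.abs.mul_const _)
    (Filter.Eventually.of_forall fun x hx => (hexp _).mul_left _)
  have hterm : ∀ m : ℕ, ∫ x in (0 : ℝ)..t, w x * ((L * (t - x)) ^ m / (m.factorial : ℝ)) =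
      (t ^ z / Real.pi * betaFn (1 / 2) ((z : ℝ) + 1 / 2)) *
      (((ascPochhammer ℝ m).eval (1 / 2 : ℝ) / (ascPochhammer ℝ m).eval ((z : ℝ) + 1)) *
        (L * t) ^ m / (m.factorial : ℝ)) := by
    intro m
    have e : ∀ x : ℝ, w x * ((L * (t - x)) ^ m / (m.factorial : ℝ)) =
        (L ^ m / (m.factorial : ℝ)) *
          (x ^ z * (t - x) ^ m * (1 / (Real.pi * Real.sqrt (x * (t - x))))) := by
      intro x
      simp only [hw, mul_pow]; ring
    simp_rw [e]
    rw [intervalIntegral.integral_const_mul, aux_beta t ht]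
    have g1 := aux_gamma (1 / 2) (by norm_num) m
    have g2 := aux_gamma ((z : ℝ) + 1) (by positivity) m
    rw [show (z : ℝ) + 1 / 2 + (m + 1 / 2) = z + 1 + m by ring, g2, add_comm (m : ℝ), g1, betaFn,
      show (1 / 2 : ℝ) + (z + 1 / 2) = z + 1 by ring, mul_pow, pow_add]
    have p1 : (0 : ℝ) < (ascPochhammer ℝ m).eval ((z : ℝ) + 1) :=
      ascPochhammer_pos m _ (by positivity)
    have p2 : 0 < Real.Gamma ((z : ℝ) + 1) := Real.Gamma_pos_of_pos (by positivity)
    have p3 : (0 : ℝ) < m.factorial := by positivity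
    field_simp
  have hl : ∀ x : ℝ, x ^ z * Real.exp (-(L * x)) * (1 / (Real.pi * Real.sqrt (x * (t - x)))) =
      Real.exp (-(L * t)) * (w x * Real.exp (L * (t - x))) := by
    intro x
    rw [show -(L * x) = -(L * t) + L * (t - x) by ring, Real.exp_add]
    simp only [hw]; ring
  simp_rw [hl]
  rw [intervalIntegral.integral_const_mul, ← hs.tsum_eq]
  simp_rw [hterm]
  rw [tsum_mul_left, hyp1F1]
  ring

theorem gcp_sojourn_pmf (k : ℕ) (hk : 1 ≤ k) (l : Fin k → ℝ) (hl : ∀ j, 0 < l j)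
    (Λ : ℝ) (hΛ : Λ = ∑ j, l j) (n : ℕ) (t : ℝ) (ht : 0 < t) :
    pplus k l n t =
      ∑ x ∈ Omega k n,
        (∏ j, (l j) ^ (x j) / (Nat.factorial (x j) : ℝ)) *
          (t ^ (∑ j, x j) / Real.pi) * Real.exp (-(Λ * t)) *
          betaFn (1 / 2) ((↑(∑ j, x j) : ℝ) + 1 / 2) *
          hyp1F1 (1 / 2) ((↑(∑ j, x j) : ℝ) + 1) (Λ * t) := by
  have hprod : ∀ (x : Fin k → ℕ) (s : ℝ),
      ∏ j, ((l j * s) ^ (x j) / (Nat.factorial (x j) : ℝ) * Real.exp (-(l j * s))) =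
      (∏ j, (l j) ^ (x j) / (Nat.factorial (x j) : ℝ)) *
        (s ^ (∑ j, x j) * Real.exp (-(Λ * s))) := by
    intro x s
    rw [hΛ, Finset.sum_mul, ← Finset.sum_neg_distrib, Real.exp_sum,
      ← Finset.prod_pow_eq_pow_sum, ← Finset.prod_mul_distrib, ← Finset.prod_mul_distrib]
    refine Finset.prod_congr rfl fun j _ => ?_
    rw [mul_pow]; ring
  unfold pplus gcp
  simp_rw [hprod, Finset.sum_mul, mul_assoc (∏ j, (l j) ^ _ / _)]
  rw [intervalIntegral.integral_finsetSum]
  · refine Finset.sum_congr rfl fun x _ => ?_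
    rw [intervalIntegral.integral_const_mul, aux_main t ht Λ]
  · intro x _
    refine IntervalIntegrable.const_mul ?_ _
    have h := (aux_int t ht (∑ j, x j) 0).mul_continuousOn
      (g := fun s => Real.exp (-(Λ * s))) (by fun_prop)
    refine h.congr ?_
    intro s _
    simp only [pow_zero]
    ring
end
end

section
/- For every u with |u| ≤ 1 and every t > 0, writing c(u) = ∑_{j=1}^k (λ_j/2)(u^j − 1), one has ∫_0^t exp(2 c(u) x)/(π√(x(t−x))) dx = e^{c(u) t} I₀(c(u) t), where I₀(z) = (1/π)∫_0^π e^{z cos θ} dθ. (This is the probability generating function of the GCP time-changed by the Brownian sojourn time on the positive half-line.) -/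
noncomputable section
open MeasureTheory Real Finset

/-- The Bessel function of order 0: I₀(z) = (1/π) ∫_0^π e^{z cos θ} dθ. -/
def besselI0 (z : ℝ) : ℝ := (1 / Real.pi) * ∫ θ in (0 : ℝ)..Real.pi, Real.exp (z * Real.cos θ)

theorem gcp_sojourn_pgf (k : ℕ) (hk : 1 ≤ k) (l : Fin k → ℝ) (hl : ∀ j, 0 < l j)
    (u t : ℝ) (hu : |u| ≤ 1) (ht : 0 < t)
    (c : ℝ) (hc : c = ∑ j, (l j / 2) * (u ^ (j.val + 1) - 1)) :
    (∫ x in (0 : ℝ)..t, Real.exp (2 * c * x) / (Real.pi * Real.sqrt (x * (t - x)))) =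
      Real.exp (c * t) * besselI0 (c * t) := by
  clear hc hu hl hk
  have himg : (fun θ : ℝ => t / 2 * (1 + Real.cos θ)) '' Set.Ioo 0 Real.pi = Set.Ioo 0 t := by
    ext x
    constructor
    · rintro ⟨θ, ⟨h0, h1⟩, rfl⟩
      have hs := Real.sin_pos_of_pos_of_lt_pi h0 h1
      have h2 := Real.sin_sq_add_cos_sq θ
      have h3 : -1 < Real.cos θ := by nlinarith [Real.neg_one_le_cos θ, Real.cos_le_one θ]
      have h4 : Real.cos θ < 1 := by nlinarith [Real.neg_one_le_cos θ, Real.cos_le_one θ]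
      constructor
      · show 0 < t / 2 * (1 + Real.cos θ)
        have : 0 < 1 + Real.cos θ := by linarith
        positivity
      · show t / 2 * (1 + Real.cos θ) < t
        nlinarith
    · rintro ⟨h0, h1⟩
      have ha : -1 < 2 * x / t - 1 := by
        have : 0 < 2 * x / t := by positivity
        linarith
      have hb : 2 * x / t - 1 < 1 := by
        have : 2 * x / t < 2 := by rw [div_lt_iff₀ ht]; linarith
        linarith
      refine ⟨Real.arccos (2 * x / t - 1), ⟨Real.arccos_pos.2 hb, ?_⟩, ?_⟩
      · refine lt_of_le_of_ne (Real.arccos_le_pi _) ?_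
        intro h
        have := Real.arccos_eq_pi.1 h
        linarith
      · show t / 2 * (1 + Real.cos (Real.arccos (2 * x / t - 1))) = x
        rw [Real.cos_arccos ha.le hb.le]
        field_simp
        ring
  have hinj : Set.InjOn (fun θ : ℝ => t / 2 * (1 + Real.cos θ)) (Set.Ioo 0 Real.pi) := by
    intro a ha b hb hab
    refine Real.injOn_cos (Set.Ioo_subset_Icc_self ha) (Set.Ioo_subset_Icc_self hb) ?_
    have h := mul_left_cancel₀ (by positivity : t / 2 ≠ 0) hab
    linarith
  have hder : ∀ θ ∈ Set.Ioo 0 Real.pi, HasDerivWithinAt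
      (fun θ : ℝ => t / 2 * (1 + Real.cos θ)) (t / 2 * (-Real.sin θ)) (Set.Ioo 0 Real.pi) θ := by
    intro θ _
    exact (((Real.hasDerivAt_cos θ).const_add 1).const_mul (t / 2)).hasDerivWithinAt
  have key := integral_image_eq_integral_abs_deriv_smul measurableSet_Ioo hder hinj
    (fun x => Real.exp (2 * c * x) / (Real.pi * Real.sqrt (x * (t - x))))
  rw [himg] at key
  rw [intervalIntegral.integral_of_le ht.le, integral_Ioc_eq_integral_Ioo, key, besselI0,
    intervalIntegral.integral_of_le Real.pi_pos.le, integral_Ioc_eq_integral_Ioo, ← mul_assoc,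
    ← integral_const_mul]
  refine setIntegral_congr_fun measurableSet_Ioo ?_
  intro θ hθ
  have hs := Real.sin_pos_of_pos_of_lt_pi hθ.1 hθ.2
  have h2 := Real.sin_sq_add_cos_sq θ
  have hsq : Real.sqrt (t / 2 * (1 + Real.cos θ) * (t - t / 2 * (1 + Real.cos θ)))
      = t / 2 * Real.sin θ := by
    rw [show t / 2 * (1 + Real.cos θ) * (t - t / 2 * (1 + Real.cos θ))
      = (t / 2 * Real.sin θ) ^ 2 by linear_combination (-t ^ 2 / 4) * h2]
    exact Real.sqrt_sq (by positivity)
  have habs : |t / 2 * (-Real.sin θ)| = t / 2 * Real.sin θ := by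
    rw [mul_neg, abs_neg, abs_of_pos (by positivity)]
  have hexp : Real.exp (2 * c * (t / 2 * (1 + Real.cos θ)))
      = Real.exp (c * t) * Real.exp (c * t * Real.cos θ) := by
    rw [← Real.exp_add]
    congr 1
    ring
  simp only [smul_eq_mul]
  rw [hsq, habs, hexp]
  have hpi := Real.pi_pos
  field_simp
end
end
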